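/- Every simple graph G on 26 vertices such that G contains no irredundant set of cardinality 9 and the complement of G contains no irredundant set of cardinality 3 is 5-regular (every vertex has degree exactly 5 in G). -/

import Mathlib

/-- A set `X` of vertices is irredundant in `G` if every `x ∈ X` is either isolated in the
induced subgraph on `X`, or has a private neighbor `y ∉ X` adjacent to `x` and to no other
vertex of `X`. -/
def SimpleGraph.IsIrredundant {V : Type*} (G : SimpleGraph V) (X : Finset V) : Prop :=
  ∀ x ∈ X, (∀ y ∈ X, ¬ G.Adj x y) ∨
    ∃ y, y ∉ X ∧ G.Adj x y ∧ ∀ z ∈ X, z ≠ x → ¬ G.Adj z y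

/-- A set `X` of vertices is independent in `G` if no two of its vertices are adjacent. -/
def SimpleGraph.IsIndependent {V : Type*} (G : SimpleGraph V) (X : Finset V) : Prop :=
  ∀ x ∈ X, ∀ y ∈ X, ¬ G.Adj x y

/-- The mixed Ramsey number `t(m,n)`: the smallest `N` such that for every red-blue coloring
of the edges of `K_N` (the red graph being `G`, the blue graph its complement `Gᶜ`), the blue
graph contains an `m`-element irredundant set or the red graph contains an `n`-element
independent set. -/
noncomputable def mixedRamsey (m n : ℕ) : ℕ :=
  sInf {N : ℕ | ∀ G : SimpleGraph (Fin N),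
    (∃ X : Finset (Fin N), X.card = m ∧ Gᶜ.IsIrredundant X) ∨
    (∃ X : Finset (Fin N), X.card = n ∧ G.IsIndependent X)}

/-- The irredundant Ramsey number `s(m,n)`: the smallest `N` such that for every red-blue
coloring of the edges of `K_N` (red graph `G`, blue graph `Gᶜ`), the blue graph contains an
`m`-element irredundant set or the red graph contains an `n`-element irredundant set. -/
noncomputable def irredundantRamsey (m n : ℕ) : ℕ :=
  sInf {N : ℕ | ∀ G : SimpleGraph (Fin N),
    (∃ X : Finset (Fin N), X.card = m ∧ Gᶜ.IsIrredundant X) ∨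
    (∃ X : Finset (Fin N), X.card = n ∧ G.IsIrredundant X)}

/-- The Ramsey number `r(m,n)`: the smallest `N` such that for every red-blue coloring of the
edges of `K_N` (red graph `G`, blue graph `Gᶜ`), the blue graph contains an `m`-element
independent set or the red graph contains an `n`-element independent set. -/
noncomputable def ramsey (m n : ℕ) : ℕ :=
  sInf {N : ℕ | ∀ G : SimpleGraph (Fin N),
    (∃ X : Finset (Fin N), X.card = m ∧ Gᶜ.IsIndependent X) ∨
    (∃ X : Finset (Fin N), X.card = n ∧ G.IsIndependent X)}

set_option linter.unusedSectionVars false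
namespace IRR
open Finset

variable {V : Type*} [DecidableEq V] {G : SimpleGraph V} [DecidableRel G.Adj]

structure CG (G : SimpleGraph V) : Prop where
  tf : ∀ a b c, G.Adj a b → G.Adj b c → ¬ G.Adj a c
  c6 : ∀ a b c d e f, G.Adj a b → G.Adj b c → G.Adj c d → G.Adj d e → G.Adj e f → G.Adj f a →
    G.Adj a d ∨ G.Adj b e ∨ G.Adj c f

def Irr (G : SimpleGraph V) (U X : Finset V) : Prop :=
  X ⊆ U ∧ ∀ x ∈ X, (∀ y ∈ X, ¬ G.Adj x y) ∨
    ∃ y ∈ U, y ∉ X ∧ G.Adj x y ∧ ∀ z ∈ X, z ≠ x → ¬ G.Adj z y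

def IRle (G : SimpleGraph V) (U : Finset V) (k : ℕ) : Prop := ∀ X, Irr G U X → X.card ≤ k

def Ind (G : SimpleGraph V) (X : Finset V) : Prop := ∀ x ∈ X, ∀ y ∈ X, ¬ G.Adj x y

def Far (G : SimpleGraph V) (I W : Finset V) : Prop := ∀ w ∈ W, w ∉ I ∧ ∀ i ∈ I, ¬ G.Adj i w

theorem cover0 {U I W X : Finset V} {k : ℕ} (h : IRle G U k) (hI : Ind G I) (hIU : I ⊆ U)
    (hW : W ⊆ U) (hf : Far G I W) (hX : Irr G W X) : X.card + I.card ≤ k := by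
  have hd : Disjoint X I := by
    rw [Finset.disjoint_left]
    intro x hx
    exact (hf x (hX.1 hx)).1
  rw [← Finset.card_union_of_disjoint hd]
  apply h
  refine ⟨Finset.union_subset (hX.1.trans hW) hIU, ?_⟩
  intro x hx
  rcases Finset.mem_union.1 hx with hx | hx
  · rcases hX.2 x hx with h1 | ⟨y, hy, hyX, hxy, hz⟩
    · left
      intro y hy
      rcases Finset.mem_union.1 hy with hy | hy
      · exact h1 y hy
      · intro hadj
        exact (hf x (hX.1 hx)).2 y hy hadj.symm
    · right
      refine ⟨y, hW hy, ?_, hxy, ?_⟩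
      · intro hh
        rcases Finset.mem_union.1 hh with hh | hh
        · exact hyX hh
        · exact (hf y hy).1 hh
      · intro z hzz hne
        rcases Finset.mem_union.1 hzz with hzz | hzz
        · exact hz z hzz hne
        · exact (hf y hy).2 z hzz
  · left
    intro y hy
    rcases Finset.mem_union.1 hy with hy | hy
    · exact (hf y (hX.1 hy)).2 x hx
    · exact hI x hx y hy

theorem cover {U I W : Finset V} {k : ℕ} (j : ℕ) (h : IRle G U k) (hI : Ind G I) (hIU : I ⊆ U)
    (hW : W ⊆ U) (hf : Far G I W) (hk : k ≤ j + I.card) : IRle G W j := by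
  intro X hX
  have := cover0 h hI hIU hW hf hX
  omega

theorem ind_irr {U X : Finset V} (hX : Ind G X) (hXU : X ⊆ U) : Irr G U X :=
  ⟨hXU, fun x hx => Or.inl (fun y hy => hX x hx y hy)⟩

theorem ind_le {U X : Finset V} {k : ℕ} (h : IRle G U k) (hX : Ind G X) (hXU : X ⊆ U) :
    X.card ≤ k := h X (ind_irr hX hXU)

theorem IRle.mono {U W : Finset V} {k : ℕ} (h : IRle G U k) (hW : W ⊆ U) : IRle G W k := by
  apply cover (I := ∅) k h <;> simp [Ind, Far, hW]

theorem IRle.mono' {U : Finset V} {k j : ℕ} (h : IRle G U k) (hW : k ≤ j) : IRle G U j :=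
  fun X hX => (h X hX).trans hW

def CW (G : SimpleGraph V) (W : Finset V) (n : ℕ) (f : ℕ → V) : Prop :=
  (∀ i, f i ∈ W) ∧ (∀ i, G.Adj (f i) (f (i+1))) ∧ ∀ i, f (i + n) = f i

def Bip (G : SimpleGraph V) (W : Finset V) : Prop :=
  ∃ c : V → Bool, ∀ x ∈ W, ∀ y ∈ W, G.Adj x y → c x ≠ c y

/-- cyclic closing of a path -/
theorem close_walk {W : Finset V} {f : ℕ → V} (n : ℕ) (hn : 0 < n) (hf : ∀ i < n, f i ∈ W)
    (ha : ∀ i, i + 1 < n → G.Adj (f i) (f (i+1))) (hc : G.Adj (f (n-1)) (f 0)) :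
    CW G W n (fun i => f (i % n)) := by
  refine ⟨fun i => hf _ (Nat.mod_lt _ hn), fun i => ?_, fun i => by simp⟩
  have h1 := Nat.mod_lt i hn
  by_cases h : i % n + 1 < n
  · have : (i+1) % n = i % n + 1 := by
      rw [Nat.add_mod]
      rcases Nat.lt_or_ge 1 n with h2 | h2
      · rw [Nat.mod_eq_of_lt h2, Nat.mod_eq_of_lt h]
      · omega
    simp only [this]
    exact ha _ h
  · have h3 : i % n = n - 1 := by omega
    have : (i+1) % n = 0 := by
      have h4 := Nat.div_add_mod i n
      have : i + 1 = n * (i / n + 1) := by rw [mul_add]; omega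
      rw [this]; simp
    simp only [this, h3]
    exact hc

theorem exists_cw {W : Finset V} (h : ¬ Bip G W) : ∃ n f, Odd n ∧ CW G W n f := by
  have h1 : ¬ (G.induce (W : Set V)).Colorable 2 := by
    rintro ⟨C⟩
    apply h
    refine ⟨fun x => if hx : x ∈ W then decide (C ⟨x, hx⟩ = 0) else false, ?_⟩
    intro x hx y hy hxy
    have := C.valid (v := ⟨x, hx⟩) (w := ⟨y, hy⟩) (by simpa using hxy)
    simp only [hx, hy, dif_pos]
    intro h5
    apply this
    rw [decide_eq_decide] at h5
    omega
  rw [SimpleGraph.two_colorable_iff_forall_loop_even] at h1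
  push Not at h1
  obtain ⟨u, w, hw⟩ := h1
  rw [Nat.not_even_iff_odd] at hw
  have hpos : 0 < w.length := hw.pos
  refine ⟨w.length, _, hw, close_walk (f := fun i => (w.getVert i).1) w.length hpos ?_ ?_ ?_⟩
  · intro i _
    exact (w.getVert i).2
  · intro i hi
    exact w.adj_getVert_succ (by omega)
  · have := w.adj_getVert_succ (i := w.length - 1) (by omega)
    rw [Nat.sub_add_cancel hpos] at this
    simpa using this

theorem CW.shift {W : Finset V} {n : ℕ} {f : ℕ → V} (h : CW G W n f) (j : ℕ) :
    CW G W n (fun i => f (j + i)) :=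
  ⟨fun i => h.1 _, fun i => h.2.1 _, fun i => by
    show f (j + (i + n)) = f (j + i); rw [← h.2.2 (j+i), add_assoc]⟩

theorem odd_walk (hG : CG G) {W : Finset V} (h : ¬ Bip G W) :
    ∃ n f, Odd n ∧ 5 ≤ n ∧ CW G W n f ∧ (∀ i, ¬ G.Adj (f i) (f (i+3))) ∧
      ∀ i t, 0 < t → t < n → f (i + t) ≠ f i := by
  classical
  have hex : ∃ n, Odd n ∧ ∃ f, CW G W n f := by
    obtain ⟨n, f, h1, h2⟩ := exists_cw h
    exact ⟨n, h1, f, h2⟩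
  obtain ⟨hodd, f, hf⟩ := Nat.find_spec hex
  have hmin : ∀ m, m < Nat.find hex → Odd m → ∀ f, ¬ CW G W m f := by
    intro m hm hmo f hf
    exact Nat.find_min hex hm ⟨hmo, f, hf⟩
  set n := Nat.find hex with hn
  clear_value n
  have h5 : 5 ≤ n := by
    by_contra hlt
    have : n = 1 ∨ n = 3 := by
      obtain ⟨k, hk⟩ := hodd
      omega
    rcases this with rfl | rfl
    · have := hf.2.1 0
      rw [hf.2.2 0] at this
      exact G.loopless.irrefl _ this
    · have h0 := hf.2.1 0
      have h1 := hf.2.1 1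
      have h2 := hf.2.1 2
      have h3 := hf.2.2 0
      simp only [zero_add] at *
      norm_num at h0 h1 h2
      rw [h3] at h2
      exact hG.tf _ _ _ h0 h1 h2.symm
  refine ⟨n, f, hodd, h5, hf, ?_, ?_⟩
  · intro i hadj
    have hs := hf.shift (i + 3)
    refine hmin (n-2) (by omega) ?_ _
      (close_walk (G := G) (W := W) (f := fun t => f (i + 3 + t)) (n-2) (by omega) ?_ ?_ ?_)
    · obtain ⟨k, hk⟩ := hodd
      exact ⟨k-1, by omega⟩
    · intro t _; exact hs.1 t
    · intro t _; exact hs.2.1 t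
    · have h6 := hf.2.2 i
      have : i + 3 + (n - 2 - 1) = i + n := by omega
      simp only [this, h6, add_zero]
      exact hadj
  · have key : ∀ i t, Odd t → t < n → f (i + t) ≠ f i := by
      intro i t ht htn he
      have hs := hf.shift i
      have htp := ht.pos
      refine hmin t htn ht _
        (close_walk (G := G) (W := W) (f := fun s => f (i + s)) t htp ?_ ?_ ?_)
      · intro t _; exact hs.1 t
      · intro t _; exact hs.2.1 t
      · have h6 := hs.2.1 (t-1)
        have : i + (t - 1 + 1) = i + t := by omega
        simp only [this, he] at h6
        simpa using h6
    intro i t ht htn he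
    rcases Nat.even_or_odd t with h7 | h7
    · refine key (i+t) (n-t) ?_ (by omega) ?_
      · exact Nat.Odd.sub_even (by omega) hodd h7
      · have : i + t + (n - t) = i + n := by omega
        rw [this, hf.2.2, he]
    · exact key i t h7 htn he

theorem Bip.card_le {W : Finset V} {m : ℕ} (h : Bip G W)
    (hm : ∀ X ⊆ W, Ind G X → X.card ≤ m) : W.card ≤ 2 * m := by
  obtain ⟨c, hc⟩ := h
  have h1 := Finset.card_filter_add_card_filter_not (s := W) (fun x => c x = true)
  have h2 := hm (W.filter (fun x => c x = true)) (Finset.filter_subset _ _) (by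
    intro x hx y hy hxy
    simp only [Finset.mem_filter] at hx hy
    exact hc x hx.1 y hy.1 hxy (by rw [hx.2, hy.2]))
  have h3 := hm (W.filter (fun x => ¬ c x = true)) (Finset.filter_subset _ _) (by
    intro x hx y hy hxy
    simp only [Finset.mem_filter] at hx hy
    have := hc x hx.1 y hy.1 hxy
    simp_all)
  omega

end IRR

namespace IRR
open Finset

variable {V : Type*} [DecidableEq V] {G : SimpleGraph V} [DecidableRel G.Adj]

variable (G) in
def SS (A : Finset V) (w : V) : Finset V := A.filter (fun a => G.Adj a w)

theorem mem_SS {A : Finset V} {w a : V} : a ∈ SS G A w ↔ a ∈ A ∧ G.Adj a w := by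
  simp [SS]

/-- `W` consists of second neighbours -/
def Sec (G : SimpleGraph V) [DecidableRel G.Adj] (v : V) (A W : Finset V) : Prop :=
  (∀ a ∈ A, G.Adj v a) ∧ ∀ w ∈ W, ¬ G.Adj v w ∧ (SS G A w).Nonempty

theorem R0 (hG : CG G) {A : Finset V} {w w' a : V} (h : G.Adj w w') (ha : a ∈ SS G A w) :
    a ∉ SS G A w' := by
  rw [mem_SS] at *
  rintro ⟨_, h2⟩
  exact hG.tf _ _ _ ha.2 h h2

theorem R1 (hG : CG G) {v : V} {A : Finset V} (hA : ∀ a ∈ A, G.Adj v a) {x w w' : V}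
    (hx : ¬ G.Adj v x) (h1 : G.Adj x w) (h2 : G.Adj x w') :
    SS G A w ⊆ SS G A w' ∨ SS G A w' ⊆ SS G A w := by
  by_contra hcon
  push Not at hcon
  obtain ⟨h3, h4⟩ := hcon
  rw [Finset.not_subset] at h3 h4
  obtain ⟨a, ha, ha'⟩ := h3
  obtain ⟨b, hb, hb'⟩ := h4
  rw [mem_SS] at *
  have := hG.c6 v a w x w' b (hA a ha.1) ha.2 h1.symm h2 hb.2.symm (hA b hb.1).symm
  rcases this with h | h | h
  · exact hx h
  · exact ha' ⟨ha.1, h⟩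
  · exact hb' ⟨hb.1, h.symm⟩

/-- comparable nonempty label sets meet -/
theorem R1' (hG : CG G) {v : V} {A : Finset V} (hA : ∀ a ∈ A, G.Adj v a) {x w w' : V}
    (hx : ¬ G.Adj v x) (h1 : G.Adj x w) (h2 : G.Adj x w') (hw : (SS G A w).Nonempty)
    (hw' : (SS G A w').Nonempty) : ∃ b, b ∈ SS G A w ∧ b ∈ SS G A w' := by
  rcases R1 hG hA hx h1 h2 with h | h
  · obtain ⟨b, hb⟩ := hw
    exact ⟨b, hb, h hb⟩
  · obtain ⟨b, hb⟩ := hw'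
    exact ⟨b, h hb, hb⟩

theorem R2 (hG : CG G) {v : V} {A : Finset V} (hA : ∀ a ∈ A, G.Adj v a) {x w x' w' a b : V}
    (h1 : G.Adj x w) (h2 : G.Adj x' w') (h3 : ¬ G.Adj x w') (h4 : ¬ G.Adj w x')
    (ha : a ∈ SS G A x) (ha' : a ∈ SS G A x') (hb : b ∈ SS G A w) (hb' : b ∈ SS G A w') :
    False := by
  rw [mem_SS] at *
  rcases hG.c6 a x w b w' x' ha.2 h1 hb.2.symm hb'.2 h2.symm ha'.2.symm with h | h | h
  · exact hG.tf _ _ _ (hA a ha.1) h (hA b hb.1)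
  · exact h3 h
  · exact h4 h

theorem P5 (hG : CG G) {v : V} {A : Finset V} (hA : ∀ a ∈ A, G.Adj v a) {x0 x1 x2 x3 x4 : V}
    (h01 : G.Adj x0 x1) (h12 : G.Adj x1 x2) (h23 : G.Adj x2 x3) (h34 : G.Adj x3 x4)
    (h03 : ¬ G.Adj x0 x3) (h14 : ¬ G.Adj x1 x4) (hv2 : ¬ G.Adj v x2)
    (hn1 : (SS G A x1).Nonempty) (hn3 : (SS G A x3).Nonempty) :
    ∀ a, a ∈ SS G A x0 → a ∉ SS G A x4 := by
  intro a ha ha'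
  obtain ⟨b, hb, hb'⟩ := R1' hG hA hv2 h12.symm h23 hn1 hn3
  exact R2 hG hA h01 h34.symm h03 h14 ha ha' hb hb'

theorem peak (hG : CG G) {v : V} {A W : Finset V} (hS : Sec G v A W) {x0 x1 x2 x3 x4 : V}
    (h01 : G.Adj x0 x1) (h12 : G.Adj x1 x2) (h23 : G.Adj x2 x3) (h34 : G.Adj x3 x4)
    (h03 : ¬ G.Adj x0 x3) (h14 : ¬ G.Adj x1 x4) (h0 : x0 ∈ W) (h1 : x1 ∈ W) (h2 : x2 ∈ W)
    (h3 : x3 ∈ W) (h4 : x4 ∈ W) : SS G A x0 ⊆ SS G A x2 ∧ SS G A x4 ⊆ SS G A x2 := by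
  obtain ⟨hA, hW⟩ := hS
  have hd := P5 hG hA h01 h12 h23 h34 h03 h14 (hW x2 h2).1 (hW x1 h1).2 (hW x3 h3).2
  obtain ⟨c0, hc0⟩ := (hW x0 h0).2
  obtain ⟨c2, hc2⟩ := (hW x2 h2).2
  obtain ⟨c4, hc4⟩ := (hW x4 h4).2
  rcases R1 hG hA (hW x1 h1).1 h01.symm h12 with h | h <;>
  rcases R1 hG hA (hW x3 h3).1 h23.symm h34 with h' | h'
  · exact absurd (h' (h hc0)) (hd _ hc0)
  · exact ⟨h, h'⟩
  · exact absurd (h' hc2) (hd _ (h hc2))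
  · exact absurd hc4 (hd _ (h (h' hc4)))

theorem two_peaks (hG : CG G) {v : V} {A W : Finset V} (hS : Sec G v A W) (f : ℕ → V)
    (hf : ∀ i < 7, f i ∈ W) (ha : ∀ i < 6, G.Adj (f i) (f (i+1)))
    (h3 : ∀ i < 4, ¬ G.Adj (f i) (f (i+3))) : False := by
  have p1 := peak hG hS (ha 0 (by omega)) (ha 1 (by omega)) (ha 2 (by omega)) (ha 3 (by omega))
    (h3 0 (by omega)) (h3 1 (by omega)) (hf _ (by omega)) (hf _ (by omega)) (hf _ (by omega))
    (hf _ (by omega)) (hf _ (by omega))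
  have p2 := peak hG hS (ha 2 (by omega)) (ha 3 (by omega)) (ha 4 (by omega)) (ha 5 (by omega))
    (h3 2 (by omega)) (h3 3 (by omega)) (hf _ (by omega)) (hf _ (by omega)) (hf _ (by omega))
    (hf _ (by omega)) (hf _ (by omega))
  have hd := P5 hG hS.1 (ha 0 (by omega)) (ha 1 (by omega)) (ha 2 (by omega)) (ha 3 (by omega))
    (h3 0 (by omega)) (h3 1 (by omega)) (hS.2 _ (hf _ (by omega))).1
    (hS.2 _ (hf _ (by omega))).2 (hS.2 _ (hf _ (by omega))).2
  obtain ⟨c, hc⟩ := (hS.2 _ (hf 0 (by omega))).2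
  exact hd c hc (p2.1 (p1.1 hc))

theorem bip_insert (hG : CG G) {v y : V} {A W : Finset V} (hS : Sec G v A W) (hy : ¬ G.Adj v y) :
    Bip G (insert y W) := by
  by_contra hb
  obtain ⟨n, f, hodd, h5, hcw, h3, hdist⟩ := odd_walk hG hb
  have hW : ∀ i, f i ≠ y → f i ∈ W := by
    intro i hi
    have := hcw.1 i
    rw [Finset.mem_insert] at this
    tauto
  by_cases hex : ∃ j, f j = y
  swap
  · push Not at hex
    exact two_peaks hG hS f (fun i _ => hW i (hex i)) (fun i _ => hcw.2.1 i) (fun i _ => h3 i)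
  obtain ⟨j, hj⟩ := hex
  have hne : ∀ t, 0 < t → t < n → f (j + t) ∈ W := by
    intro t h1 h2
    apply hW
    rw [← hj]
    exact hdist j t h1 h2
  have had : ∀ t, G.Adj (f (j + t)) (f (j + (t+1))) := fun t => hcw.2.1 (j+t)
  have h3' : ∀ t, ¬ G.Adj (f (j + t)) (f (j + (t+3))) := fun t => h3 (j+t)
  by_cases h9 : 9 ≤ n
  · exact two_peaks hG hS (fun i => f (j + (i + 2))) (fun i hi => hne _ (by omega) (by omega))
      (fun i _ => had (i+2)) (fun i _ => h3' (i+2))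
  have h57 : n = 5 ∨ n = 7 := by
    obtain ⟨k, hk⟩ := hodd
    omega
  have y1 : G.Adj y (f (j+1)) := by
    rw [← hj]; exact hcw.2.1 j
  rcases h57 with rfl | rfl
  · have y4 : G.Adj y (f (j+4)) := by
      have := had 4
      rw [hcw.2.2 j, hj] at this
      exact this.symm
    have m1 := hne 1 (by omega) (by omega)
    have m2 := hne 2 (by omega) (by omega)
    have m3 := hne 3 (by omega) (by omega)
    have m4 := hne 4 (by omega) (by omega)
    rcases R1 hG hS.1 hy y1 y4 with h | h
    · obtain ⟨b, hb, hb'⟩ := R1' hG hS.1 (hS.2 _ m2).1 (had 1).symm (had 2) (hS.2 _ m1).2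
        (hS.2 _ m3).2
      exact R0 hG (had 3) hb' (h hb)
    · obtain ⟨b, hb, hb'⟩ := R1' hG hS.1 (hS.2 _ m3).1 (had 2).symm (had 3) (hS.2 _ m2).2
        (hS.2 _ m4).2
      exact R0 hG (had 1) (h hb') hb
  · have y6 : G.Adj y (f (j+6)) := by
      have := had 6
      rw [hcw.2.2 j, hj] at this
      exact this.symm
    have m1 := hne 1 (by omega) (by omega)
    have m2 := hne 2 (by omega) (by omega)
    have m3 := hne 3 (by omega) (by omega)
    have m4 := hne 4 (by omega) (by omega)
    have m5 := hne 5 (by omega) (by omega)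
    have m6 := hne 6 (by omega) (by omega)
    have p1 := peak hG hS (had 2) (had 3) (had 4) (had 5) (h3' 2) (h3' 3) m2 m3 m4 m5 m6
    have p2 := peak hG hS (had 1) (had 2) (had 3) (had 4) (h3' 1) (h3' 2) m1 m2 m3 m4 m5
    obtain ⟨b, hb, hb'⟩ := R1' hG hS.1 hy y1 y6 (hS.2 _ m1).2 (hS.2 _ m6).2
    exact R0 hG (had 3) (p2.1 hb) (p1.2 hb')

/-- layers -/
def NN (G : SimpleGraph V) [DecidableRel G.Adj] (U : Finset V) (v : V) : Finset V :=
  U.filter (fun a => G.Adj v a)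
def BB (G : SimpleGraph V) [DecidableRel G.Adj] (U : Finset V) (v : V) : Finset V :=
  U.filter (fun w => w ≠ v ∧ ¬ G.Adj v w)
def L2 (G : SimpleGraph V) [DecidableRel G.Adj] (U : Finset V) (v : V) : Finset V :=
  (BB G U v).filter (fun w => (SS G (NN G U v) w).Nonempty)
def L3 (G : SimpleGraph V) [DecidableRel G.Adj] (U : Finset V) (v : V) : Finset V :=
  (BB G U v).filter (fun w => ¬ (SS G (NN G U v) w).Nonempty)

theorem mem_NN {U : Finset V} {v a : V} : a ∈ NN G U v ↔ a ∈ U ∧ G.Adj v a := by simp [NN]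
theorem mem_BB {U : Finset V} {v a : V} : a ∈ BB G U v ↔ a ∈ U ∧ a ≠ v ∧ ¬ G.Adj v a := by
  simp [BB]
theorem mem_L2 {U : Finset V} {v a : V} :
    a ∈ L2 G U v ↔ a ∈ BB G U v ∧ (SS G (NN G U v) a).Nonempty := by simp [L2]
theorem mem_L3 {U : Finset V} {v a : V} :
    a ∈ L3 G U v ↔ a ∈ BB G U v ∧ ∀ b ∈ NN G U v, ¬ G.Adj b a := by
  simp only [L3, Finset.mem_filter, Finset.not_nonempty_iff_eq_empty, SS,
    Finset.filter_eq_empty_iff]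

theorem card_BB {U : Finset V} {v : V} (hv : v ∈ U) :
    U.card = 1 + (NN G U v).card + (BB G U v).card := by
  have h1 : U = insert v (NN G U v ∪ BB G U v) := by
    ext x
    simp only [Finset.mem_insert, Finset.mem_union, mem_NN, mem_BB]
    by_cases hx : x = v
    · subst hx; simp [hv]
    · tauto
  have h2 : v ∉ NN G U v ∪ BB G U v := by
    simp [mem_NN, mem_BB]
  have h3 : Disjoint (NN G U v) (BB G U v) := by
    rw [Finset.disjoint_left]
    intro a ha hb
    rw [mem_NN] at ha
    rw [mem_BB] at hb
    exact hb.2.2 ha.2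
  conv_lhs => rw [h1, Finset.card_insert_of_notMem h2, Finset.card_union_of_disjoint h3]
  omega

theorem card_L23 {U : Finset V} {v : V} :
    (BB G U v).card = (L2 G U v).card + (L3 G U v).card :=
  (Finset.card_filter_add_card_filter_not _).symm

theorem sec_L2 {U : Finset V} {v : V} : Sec G v (NN G U v) (L2 G U v) :=
  ⟨fun a ha => (mem_NN.1 ha).2, fun w hw => ⟨(mem_BB.1 (mem_L2.1 hw).1).2.2, (mem_L2.1 hw).2⟩⟩

theorem BB_IR {U : Finset V} {v : V} {k j : ℕ} (hv : v ∈ U) (h : IRle G U k) (hk : k ≤ j + 1) :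
    IRle G (BB G U v) j := by
  apply cover (I := {v}) j h
  · simp [Ind]
  · simpa using hv
  · exact Finset.filter_subset _ _
  · intro w hw
    rw [mem_BB] at hw
    simpa using hw.2
  · simpa using hk

theorem NN_ind (hG : CG G) {U : Finset V} {v : V} : Ind G (NN G U v) := by
  intro x hx y hy hxy
  rw [mem_NN] at hx hy
  exact hG.tf _ _ _ hx.2 hxy hy.2

theorem L3_IR (hG : CG G) {U : Finset V} {v : V} {k j : ℕ} (h : IRle G U k)
    (hk : k ≤ j + (NN G U v).card) : IRle G (L3 G U v) j := by
  apply cover (I := NN G U v) j h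
  · exact NN_ind hG
  · exact Finset.filter_subset _ _
  · exact (Finset.filter_subset _ _).trans (Finset.filter_subset _ _)
  · intro w hw
    rw [mem_L3] at hw
    refine ⟨fun h => ?_, hw.2⟩
    exact (mem_BB.1 hw.1).2.2 (mem_NN.1 h).2
  · exact hk

theorem NN_le (hG : CG G) {U : Finset V} {v : V} {k : ℕ} (h : IRle G U k) :
    (NN G U v).card ≤ k := ind_le h (NN_ind hG) (Finset.filter_subset _ _)

theorem lemA (hG : CG G) {U : Finset V} {v : V} {k j : ℕ} (hv : v ∈ U) (h : IRle G U k)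
    (hk : k ≤ j + 1) : (L2 G U v).card ≤ 2 * j := by
  have hB := BB_IR hv h hk
  have hb : Bip G (L2 G U v) := by
    obtain ⟨c, hc⟩ := bip_insert (y := v) hG (sec_L2 (G := G) (U := U) (v := v)) (by simp)
    exact ⟨c, fun x hx y hy => hc x (by simp [hx]) y (by simp [hy])⟩
  exact hb.card_le (fun X hX hi => ind_le hB hi (hX.trans (Finset.filter_subset _ _)))

theorem lemA' (hG : CG G) {U : Finset V} {v : V} {k j : ℕ} (hv : v ∈ U) (h : IRle G U k)
    (hk : k ≤ j + 1) (h3 : 0 < (L3 G U v).card) : (L2 G U v).card + 1 ≤ 2 * j := by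
  have hB := BB_IR hv h hk
  obtain ⟨y, hy⟩ := Finset.card_pos.1 h3
  have hyB := (mem_L3.1 hy).1
  have hb := bip_insert (y := y) hG (sec_L2 (G := G) (U := U) (v := v)) (mem_BB.1 hyB).2.2
  have hn : y ∉ L2 G U v := by
    intro hh
    exact (Finset.mem_filter.1 hy).2 (mem_L2.1 hh).2
  rw [← Finset.card_insert_of_notMem hn]
  refine hb.card_le (fun X hX hi => ind_le hB hi (hX.trans ?_))
  exact Finset.insert_subset hyB (Finset.filter_subset _ _)

end IRR

namespace IRR
open Finset

variable {V : Type*} [DecidableEq V] {G : SimpleGraph V} [DecidableRel G.Adj]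

theorem g0 {W : Finset V} (h : IRle G W 0) : W.card = 0 := by
  by_contra hne
  obtain ⟨x, hx⟩ := Finset.card_pos.1 (Nat.pos_of_ne_zero hne)
  have := ind_le h (X := {x}) (by simp [Ind]) (by simpa using hx)
  simp at this

theorem g1 (hG : CG G) {W : Finset V} (h : IRle G W 1) : W.card ≤ 2 := by
  rcases W.eq_empty_or_nonempty with rfl | ⟨v, hv⟩
  · simp
  have h1 := NN_le (v := v) hG h
  have h2 := g0 (BB_IR (j := 0) hv h (by omega))
  have h3 := card_BB (G := G) hv
  omega

theorem g2 (hG : CG G) {W : Finset V} (h : IRle G W 2) : W.card ≤ 5 := by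
  rcases W.eq_empty_or_nonempty with rfl | ⟨v, hv⟩
  · simp
  have h1 := NN_le (v := v) hG h
  have h2 := g1 hG (BB_IR (j := 1) hv h (by omega))
  have h3 := card_BB (G := G) hv
  omega

theorem nonadj_pair (hG : CG G) {W : Finset V} (h : 3 ≤ W.card) :
    ∃ p ∈ W, ∃ q ∈ W, p ≠ q ∧ ¬ G.Adj p q := by
  obtain ⟨a, b, c, ha, hb, hc, hab, hac, hbc⟩ := Finset.two_lt_card_iff.1 (by omega : 2 < W.card)
  by_cases h1 : G.Adj a b
  · by_cases h2 : G.Adj b c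
    · exact ⟨a, ha, c, hc, hac, hG.tf _ _ _ h1 h2⟩
    · exact ⟨b, hb, c, hc, hbc, h2⟩
  · exact ⟨a, ha, b, hb, hab, h1⟩

theorem ind3 {a b c : V} (h1 : ¬ G.Adj a b) (h2 : ¬ G.Adj a c) (h3 : ¬ G.Adj b c) :
    Ind G {a, b, c} := by
  intro x hx y hy hxy
  simp only [Finset.mem_insert, Finset.mem_singleton] at hx hy
  rcases hx with rfl | rfl | rfl <;> rcases hy with rfl | rfl | rfl <;>
    first | exact G.loopless.irrefl _ hxy | exact h1 hxy | exact h1 hxy.symm | exact h2 hxy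
          | exact h2 hxy.symm | exact h3 hxy | exact h3 hxy.symm

theorem no3 {W : Finset V} (h : IRle G W 2) {a b c : V} (ha : a ∈ W) (hb : b ∈ W) (hc : c ∈ W)
    (hab : a ≠ b) (hac : a ≠ c) (hbc : b ≠ c)
    (h1 : ¬ G.Adj a b) (h2 : ¬ G.Adj a c) (h3 : ¬ G.Adj b c) : False := by
  have := ind_le h (ind3 h1 h2 h3) (by
    intro x hx
    simp only [Finset.mem_insert, Finset.mem_singleton] at hx
    rcases hx with rfl | rfl | rfl <;> assumption)
  rw [Finset.card_eq_three.2 ⟨a, b, c, hab, hac, hbc, rfl⟩] at this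
  omega

/-- in `W` with no independent triple, nonneighbours of a vertex are at most two -/
theorem nonnb (hG : CG G) {W : Finset V} (h : IRle G W 2) {x : V} (hx : x ∈ W) :
    (BB G W x).card ≤ 2 := by
  exact g1 hG (BB_IR hx h (by omega))

theorem irr4 {U : Finset V} (h : IRle G U 3) {v a b x c p q x' : V} (hv : v ∈ U) (ha : a ∈ U)
    (hb : b ∈ U) (hx : x ∈ U) (hc : c ∈ U) (hp : p ∈ U) (hq : q ∈ U) (hx' : x' ∈ U)
    (va : G.Adj v a) (vb : G.Adj v b) (ax : G.Adj a x) (bx : G.Adj b x) (vx : v ≠ x) (ab : a ≠ b)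
    (vc : G.Adj v c) (ac : ¬ G.Adj a c) (bc : ¬ G.Adj b c) (xc : ¬ G.Adj x c)
    (ap : G.Adj a p) (vp : ¬ G.Adj v p) (bp : ¬ G.Adj b p) (xp : ¬ G.Adj x p)
    (bq : G.Adj b q) (vq : ¬ G.Adj v q) (aq : ¬ G.Adj a q) (xq : ¬ G.Adj x q)
    (xx : G.Adj x x') (vx' : ¬ G.Adj v x') (ax' : ¬ G.Adj a x') (bx' : ¬ G.Adj b x') : False := by
  have key : ∀ z y, y ∈ U → G.Adj z y → (∀ t ∈ ({v, a, b, x} : Finset V), t ≠ z → ¬ G.Adj t y) →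
      y ∉ ({v, a, b, x} : Finset V) → ∃ y ∈ U, y ∉ ({v, a, b, x} : Finset V) ∧ G.Adj z y ∧
        ∀ t ∈ ({v, a, b, x} : Finset V), t ≠ z → ¬ G.Adj t y :=
    fun z y h1 h2 h3 h4 => ⟨y, h1, h4, h2, h3⟩
  have hirr : Irr G U {v, a, b, x} := by
    constructor
    · intro z hz
      simp only [Finset.mem_insert, Finset.mem_singleton] at hz
      rcases hz with rfl | rfl | rfl | rfl <;> assumption
    · intro z hz
      right
      simp only [Finset.mem_insert, Finset.mem_singleton] at hz
      rcases hz with rfl | rfl | rfl | rfl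
      · apply key z c hc vc
        · simp [ac, bc, xc]
        · simp only [Finset.mem_insert, Finset.mem_singleton]
          rintro (rfl | rfl | rfl | rfl)
          · exact G.loopless.irrefl _ vc
          · exact xc ax.symm
          · exact xc bx.symm
          · exact ac ax
      · apply key z p hp ap
        · simp [vp, bp, xp]
        · simp only [Finset.mem_insert, Finset.mem_singleton]
          rintro (rfl | rfl | rfl | rfl)
          · exact bp vb.symm
          · exact vp va
          · exact vp vb
          · exact bp bx
      · apply key z q hq bq
        · simp [vq, aq, xq]
        · simp only [Finset.mem_insert, Finset.mem_singleton]
          rintro (rfl | rfl | rfl | rfl)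
          · exact aq va.symm
          · exact vq va
          · exact vq vb
          · exact aq ax
      · apply key z x' hx' xx
        · simp [vx', ax', bx']
        · simp only [Finset.mem_insert, Finset.mem_singleton]
          rintro (rfl | rfl | rfl | rfl)
          · exact ax' va.symm
          · exact vx' va
          · exact vx' vb
          · exact ax' ax
  have h4 := h _ hirr
  have n1 : v ∉ ({a, b, x} : Finset V) := by
    simp [va.ne, vb.ne, vx]
  have n2 : a ∉ ({b, x} : Finset V) := by
    simp [ab, ax.ne]
  rw [Finset.card_insert_of_notMem n1, Finset.card_insert_of_notMem n2, Finset.card_pair bx.ne] at h4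
  omega

theorem g3 (hG : CG G) {U : Finset V} (h : IRle G U 3) : U.card ≤ 7 := by
  suffices H : ∀ U : Finset V, IRle G U 3 → U.card = 8 → False by
    by_contra hcon
    obtain ⟨U', hU', hc⟩ := Finset.exists_subset_card_eq (by omega : 8 ≤ U.card)
    exact H U' (h.mono hU') hc
  clear h U
  intro U h hcon
  have hdeg : ∀ v ∈ U, (NN G U v).card = 3 ∨ (NN G U v).card = 2 := by
    intro v hv
    have h1 := NN_le (v := v) hG h
    have h3 := card_BB (G := G) hv
    have h7 := g2 hG (BB_IR (j := 2) hv h (by omega))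
    omega
  by_cases h3 : ∃ v ∈ U, (NN G U v).card = 3
  · obtain ⟨v, hv, hd⟩ := h3
    have hB2 : IRle G (BB G U v) 2 := BB_IR hv h (by omega)
    have hBc : (BB G U v).card = 4 := by
      have := card_BB (G := G) hv
      omega
    have hL3 : (L3 G U v).card = 0 := g0 (L3_IR (v := v) (j := 0) hG h (by omega))
    have hS : ∀ w ∈ BB G U v, (SS G (NN G U v) w).Nonempty := by
      intro w hw
      by_contra hh
      have : w ∈ L3 G U v := by
        rw [L3, Finset.mem_filter]; exact ⟨hw, hh⟩
      rw [Finset.card_eq_zero] at hL3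
      simp [hL3] at this
    have hsub : ∀ w, SS G (NN G U v) w ⊆ NN G U v := fun w => Finset.filter_subset _ _
    have hBU : BB G U v ⊆ U := Finset.filter_subset _ _
    have hAU : NN G U v ⊆ U := Finset.filter_subset _ _
    -- two vertices with the same single label
    have hsing : ∀ w ∈ BB G U v, ∀ w' ∈ BB G U v, ∀ a, w ≠ w' → SS G (NN G U v) w = {a} →
        SS G (NN G U v) w' = {a} → False := by
      intro w hw w' hw' a hne h1 h2
      have haA : a ∈ NN G U v := hsub w (by rw [h1]; simp)
      have hW : IRle G {w, w'} 1 := by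
        apply cover (I := (NN G U v).erase a) 1 h
        · intro p hp q hq
          exact NN_ind hG p (Finset.mem_of_mem_erase hp) q (Finset.mem_of_mem_erase hq)
        · exact (Finset.erase_subset _ _).trans hAU
        · intro z hz
          simp only [Finset.mem_insert, Finset.mem_singleton] at hz
          rcases hz with rfl | rfl
          · exact hBU hw
          · exact hBU hw'
        · intro z hz
          have hz1 : z ∈ BB G U v ∧ SS G (NN G U v) z = {a} := by
            simp only [Finset.mem_insert, Finset.mem_singleton] at hz
            rcases hz with rfl | rfl
            · exact ⟨hw, h1⟩
            · exact ⟨hw', h2⟩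
          refine ⟨fun hh => (mem_BB.1 hz1.1).2.2 (mem_NN.1 (Finset.mem_of_mem_erase hh)).2, ?_⟩
          intro i hi hadj
          have : i ∈ SS G (NN G U v) z := mem_SS.2 ⟨Finset.mem_of_mem_erase hi, hadj⟩
          rw [hz1.2, Finset.mem_singleton] at this
          exact (Finset.ne_of_mem_erase hi) this
        · rw [Finset.card_erase_of_mem haA]; omega
      have hww : ¬ G.Adj w w' := by
        intro hadj
        exact R0 hG hadj (a := a) (A := NN G U v) (by rw [h1]; simp) (by rw [h2]; simp)
      have := ind_le hW (X := {w, w'}) (by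
        intro p hp q hq hpq
        simp only [Finset.mem_insert, Finset.mem_singleton] at hp hq
        rcases hp with rfl | rfl <;> rcases hq with rfl | rfl
        · exact G.loopless.irrefl _ hpq
        · exact hww hpq
        · exact hww hpq.symm
        · exact G.loopless.irrefl _ hpq) (Finset.Subset.refl _)
      rw [Finset.card_pair hne] at this
      omega
    obtain ⟨x, hx, hx2⟩ : ∃ x ∈ BB G U v, 2 ≤ (SS G (NN G U v) x).card := by
      by_contra hno
      push Not at hno
      have h1 : ∀ w ∈ BB G U v, ∃ a, SS G (NN G U v) w = {a} := by
        intro w hw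
        have h2 := hno w hw
        have h3 := (hS w hw).card_pos
        exact Finset.card_eq_one.1 (by omega)
      obtain ⟨w, hw, w', hw', hne, he⟩ := Finset.exists_ne_map_eq_of_card_lt_of_maps_to
        (s := BB G U v) (t := (NN G U v).image (fun a => ({a} : Finset V)))
        (f := fun w => SS G (NN G U v) w)
        (by rw [Finset.card_image_of_injective _ Finset.singleton_injective]; omega)
        (by
          intro w hw
          obtain ⟨a, ha⟩ := h1 w hw
          simp only [Finset.coe_image, Set.mem_image, Finset.mem_coe, ha]
          exact ⟨a, hsub w (by rw [ha]; simp), rfl⟩)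
      obtain ⟨a, ha⟩ := h1 w hw
      exact hsing w hw w' hw' a hne ha (he ▸ ha)
    obtain ⟨x', hx', hxx'⟩ : ∃ x' ∈ BB G U v, G.Adj x x' := by
      by_contra hno
      push Not at hno
      have h1 := nonnb hG hB2 hx
      have h2 : BB G (BB G U v) x = (BB G U v).erase x := by
        ext z
        rw [mem_BB, Finset.mem_erase]
        constructor
        · tauto
        · intro hz; exact ⟨hz.2, hz.1, hno z hz.2⟩
      rw [h2, Finset.card_erase_of_mem hx] at h1
      omega
    have hD : ∀ w ∈ BB G U v, Disjoint (SS G (NN G U v) x) (SS G (NN G U v) w) →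
        ∃ c, SS G (NN G U v) w = {c} ∧ SS G (NN G U v) x = (NN G U v).erase c := by
      intro w hw hdj
      have h1 := Finset.card_le_card (Finset.union_subset (hsub x) (hsub w))
      rw [Finset.card_union_of_disjoint hdj] at h1
      have h2 := (hS w hw).card_pos
      obtain ⟨c, hc⟩ := Finset.card_eq_one.1 (by omega : (SS G (NN G U v) w).card = 1)
      refine ⟨c, hc, ?_⟩
      have hcA : c ∈ NN G U v := hsub w (by rw [hc]; simp)
      apply Finset.eq_of_subset_of_card_le
      · intro z hz
        rw [Finset.mem_erase]
        refine ⟨?_, hsub x hz⟩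
        rintro rfl
        exact Finset.disjoint_left.1 hdj hz (by rw [hc]; simp)
      · rw [Finset.card_erase_of_mem hcA]; omega
    have hdj0 : ∀ w, G.Adj x w → Disjoint (SS G (NN G U v) x) (SS G (NN G U v) w) := by
      intro w hw
      rw [Finset.disjoint_left]
      intro a ha
      exact R0 hG hw ha
    obtain ⟨c, hc, hxc⟩ := hD x' hx' (hdj0 x' hxx')
    have hcA : c ∈ NN G U v := hsub x' (by rw [hc]; simp)
    have hD' : ∀ w ∈ BB G U v, w ≠ x' → ∃ a ∈ SS G (NN G U v) x, a ∈ SS G (NN G U v) w := by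
      intro w hw hne
      by_contra hno
      push Not at hno
      obtain ⟨c', hc', hxc'⟩ := hD w hw (Finset.disjoint_left.2 hno)
      have hc'A : c' ∈ NN G U v := hsub w (by rw [hc']; simp)
      have : c' = c := by
        by_contra hne'
        have : c' ∈ (NN G U v).erase c := Finset.mem_erase.2 ⟨hne', hc'A⟩
        rw [← hxc, hxc'] at this
        simp at this
      subst this
      exact hsing w hw x' hx' c' hne hc' hc
    have hxne : x ≠ x' := hxx'.ne
    obtain ⟨p, q, hpq, hpqe⟩ := Finset.card_eq_two.1
      (by rw [Finset.card_erase_of_mem (by simp [hxne.symm, hx']), Finset.card_erase_of_mem hx]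
          omega : (((BB G U v).erase x).erase x').card = 2)
    have hp : p ∈ ((BB G U v).erase x).erase x' := by rw [hpqe]; simp
    have hq : q ∈ ((BB G U v).erase x).erase x' := by rw [hpqe]; simp
    simp only [Finset.mem_erase] at hp hq
    obtain ⟨a, hax, hap⟩ := hD' p hp.2.2 hp.1
    obtain ⟨b, hbx, hbq⟩ := hD' q hq.2.2 hq.1
    have hxp : ¬ G.Adj x p := fun hh => R0 hG hh hax hap
    have hxq : ¬ G.Adj x q := fun hh => R0 hG hh hbx hbq
    have hadj : G.Adj p q := by
      by_contra hno
      exact no3 hB2 hx hp.2.2 hq.2.2 hp.2.1.symm hq.2.1.symm hpq hxp hxq hno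
    have haq := R0 hG hadj hap
    have hbp := R0 hG hadj.symm hbq
    have hab : a ≠ b := by
      rintro rfl
      exact haq hbq
    have haA := hsub _ hax
    have hbA := hsub _ hbx
    have hca : c ∉ SS G (NN G U v) x := by rw [hxc]; simp
    have hax' := R0 hG hxx' hax
    have hbx' := R0 hG hxx' hbx
    have hNI := NN_ind hG (U := U) (v := v)
    have iab := hNI a haA b hbA
    have iac := hNI a haA c hcA
    have ibc := hNI b hbA c hcA
    have cax : c ≠ a := by rintro rfl; exact hca hax
    have cbx : c ≠ b := by rintro rfl; exact hca hbx
    have hcx' : c ∈ SS G (NN G U v) x' := by rw [hc]; simp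
    have haA' := mem_NN.1 haA
    have hbA' := mem_NN.1 hbA
    have hcA' := mem_NN.1 hcA
    have hxB := mem_BB.1 hx
    have hx'B := mem_BB.1 hx'
    have hpB := mem_BB.1 hp.2.2
    have hqB := mem_BB.1 hq.2.2
    exact irr4 h hv haA'.1 hbA'.1 hxB.1 hcA'.1 hpB.1 hqB.1 hx'B.1 haA'.2 hbA'.2 (mem_SS.1 hax).2
      (mem_SS.1 hbx).2 hxB.2.1.symm hab hcA'.2 iac ibc (fun hh => hca (mem_SS.2 ⟨hcA, hh.symm⟩))
      (mem_SS.1 hap).2 hpB.2.2 (fun hh => hbp (mem_SS.2 ⟨hbA, hh⟩)) hxp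
      (mem_SS.1 hbq).2 hqB.2.2 (fun hh => haq (mem_SS.2 ⟨haA, hh⟩)) hxq
      hxx' hx'B.2.2 (fun hh => hax' (mem_SS.2 ⟨haA, hh⟩)) (fun hh => hbx' (mem_SS.2 ⟨hbA, hh⟩))
  · push Not at h3
    obtain ⟨v, hv⟩ := Finset.card_pos.1 (by omega : 0 < U.card)
    have h2 : ∀ v ∈ U, (NN G U v).card = 2 := by
      intro v hv
      have := hdeg v hv
      have := h3 v hv
      omega
    obtain ⟨a, ha⟩ := Finset.card_pos.1 (by rw [h2 v hv]; omega : 0 < (NN G U v).card)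
    have ha' := mem_NN.1 ha
    have hva : v ∈ NN G U a := mem_NN.2 ⟨hv, ha'.2.symm⟩
    obtain ⟨w, hw⟩ := Finset.card_pos.1 (by
      rw [Finset.card_erase_of_mem hva, h2 a ha'.1]; omega : 0 < ((NN G U a).erase v).card)
    rw [Finset.mem_erase, mem_NN] at hw
    have hwB : w ∈ BB G U v := mem_BB.2 ⟨hw.2.1, hw.1, hG.tf _ _ _ ha'.2 hw.2.2⟩
    have hB2 : IRle G (BB G U v) 2 := BB_IR hv h (by omega)
    have c1 := card_BB (G := G) hwB
    have c2 := nonnb hG hB2 hwB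
    have c3 := card_BB (G := G) hv
    have c4 := h2 v hv
    have c5 : (NN G (BB G U v) w).card ≤ ((NN G U w).erase a).card := by
      apply Finset.card_le_card
      intro z hz
      rw [mem_NN, mem_BB] at hz
      rw [Finset.mem_erase, mem_NN]
      refine ⟨?_, hz.1.1, hz.2⟩
      rintro rfl
      exact hz.1.2.2 ha'.2
    rw [Finset.card_erase_of_mem (mem_NN.2 ⟨ha'.1, hw.2.2.symm⟩), h2 w hw.2.1] at c5
    omega

theorem g4 (hG : CG G) {U : Finset V} (h : IRle G U 4) : U.card ≤ 11 := by
  rcases U.eq_empty_or_nonempty with rfl | ⟨v, hv⟩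
  · simp
  have h1 := NN_le (v := v) hG h
  have h3 := card_BB (G := G) hv
  have h4 := card_L23 (G := G) (U := U) (v := v)
  have h5 := lemA (j := 3) hG hv h (by omega)
  have h6 := lemA' (j := 3) hG hv h (by omega)
  have h7 := g3 hG (BB_IR (j := 3) hv h (by omega))
  rcases (by omega : (NN G U v).card = 4 ∨ (NN G U v).card = 3 ∨ (NN G U v).card ≤ 2) with
    h8 | h8 | h8
  · have := g0 (L3_IR (v := v) (j := 0) hG h (by omega))
    omega
  · have := g1 hG (L3_IR (v := v) (j := 1) hG h (by omega))
    omega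
  · omega

theorem parity {U : Finset V} (h : ∀ v ∈ U, Odd (NN G U v).card) : Even U.card := by
  classical
  have h1 := (G.induce (U : Set V)).even_card_odd_degree_vertices
  have h2 : (Finset.univ.filter (fun v : (U : Set V) => Odd ((G.induce (U : Set V)).degree v)))
      = Finset.univ := by
    rw [Finset.filter_eq_self]
    rintro ⟨v, hv⟩ _
    have h3 := h v hv
    convert h3 using 1
    rw [← SimpleGraph.card_neighborFinset_eq_degree]
    apply Finset.card_bij (fun x _ => x.1)
    · intro a ha
      rw [SimpleGraph.mem_neighborFinset] at ha
      rw [mem_NN]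
      exact ⟨a.2, ha⟩
    · intro a _ b _ hab
      exact Subtype.ext hab
    · intro b hb
      rw [mem_NN] at hb
      exact ⟨⟨b, hb.1⟩, by simpa using hb.2, rfl⟩
  rw [h2] at h1
  simpa using h1

theorem g5 (hG : CG G) {U : Finset V} (h : IRle G U 5) : U.card ≤ 14 := by
  by_contra hcon
  have key : ∀ v ∈ U, (NN G U v).card = 3 ∧ U.card = 15 := by
    intro v hv
    have h1 := NN_le (v := v) hG h
    have h3 := card_BB (G := G) hv
    have h4 := card_L23 (G := G) (U := U) (v := v)
    have h5 := lemA (j := 4) hG hv h (by omega)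
    have h6 := lemA' (j := 4) hG hv h (by omega)
    have h7 := g4 hG (BB_IR (j := 4) hv h (by omega))
    rcases (by omega : (NN G U v).card = 5 ∨ (NN G U v).card = 4 ∨ (NN G U v).card ≤ 3) with
      h8 | h8 | h8
    · have := g0 (L3_IR (v := v) (j := 0) hG h (by omega))
      omega
    · have := g1 hG (L3_IR (v := v) (j := 1) hG h (by omega))
      omega
    · omega
  have hpos : 0 < U.card := by omega
  obtain ⟨v, hv⟩ := Finset.card_pos.1 hpos
  have h1 := parity (G := G) (U := U) (fun v hv => by rw [(key v hv).1]; decide)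
  rw [(key v hv).2] at h1
  revert h1; decide

end IRR

namespace IRR
open Finset

variable {V : Type*} [DecidableEq V] {G : SimpleGraph V} [DecidableRel G.Adj]

theorem ex_ind3 (hG : CG G) {W : Finset V} (h : 6 ≤ W.card) :
    ∃ I ⊆ W, Ind G I ∧ I.card = 3 := by
  obtain ⟨v, hv⟩ := Finset.card_pos.1 (by omega : 0 < W.card)
  have h1 := card_BB (G := G) hv
  by_cases h3 : 3 ≤ (NN G W v).card
  · obtain ⟨I, hI, hc⟩ := Finset.exists_subset_card_eq h3
    exact ⟨I, hI.trans (Finset.filter_subset _ _),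
      fun x hx y hy => NN_ind hG x (hI hx) y (hI hy), hc⟩
  · obtain ⟨p, hp, q, hq, hne, hpq⟩ := nonadj_pair hG (by omega : 3 ≤ (BB G W v).card)
    rw [mem_BB] at hp hq
    refine ⟨{v, p, q}, ?_, ind3 hp.2.2 hq.2.2 hpq, ?_⟩
    · intro x hx
      simp only [Finset.mem_insert, Finset.mem_singleton] at hx
      rcases hx with rfl | rfl | rfl
      · exact hv
      · exact hp.1
      · exact hq.1
    · exact Finset.card_eq_three.2 ⟨v, p, q, hp.2.1.symm, hq.2.1.symm, hne, rfl⟩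

/-- uncovered vertices -/
def RR (G : SimpleGraph V) [DecidableRel G.Adj] (U I : Finset V) : Finset V :=
  U.filter (fun w => w ∉ I ∧ ∀ i ∈ I, ¬ G.Adj i w)

theorem RR_IR {U I : Finset V} {k j : ℕ} (h : IRle G U k) (hI : Ind G I) (hIU : I ⊆ U)
    (hk : k ≤ j + I.card) : IRle G (RR G U I) j := by
  apply cover j h hI hIU (Finset.filter_subset _ _) _ hk
  intro w hw
  exact (Finset.mem_filter.1 hw).2

theorem RR_card {U I : Finset V} : 
    U.card ≤ I.card + (I.biUnion (NN G U)).card + (RR G U I).card := by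
  have : U ⊆ (I ∪ I.biUnion (NN G U)) ∪ RR G U I := by
    intro x hx
    simp only [Finset.mem_union, Finset.mem_biUnion, mem_NN, RR, Finset.mem_filter]
    by_cases h1 : x ∈ I
    · simp [h1]
    by_cases h2 : ∃ a ∈ I, G.Adj a x
    · obtain ⟨a, ha, h⟩ := h2
      exact Or.inl (Or.inr ⟨a, ha, hx, h⟩)
    · push Not at h2
      exact Or.inr ⟨hx, h1, h2⟩
  calc U.card ≤ _ := Finset.card_le_card this
    _ ≤ _ := (Finset.card_union_le _ _).trans (by gcongr; exact Finset.card_union_le _ _)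

/-- vertices of W adjacent to something in J -/
def NW (G : SimpleGraph V) [DecidableRel G.Adj] (W J : Finset V) : Finset V :=
  W.filter (fun w => ∃ a ∈ J, G.Adj a w)
def NO (G : SimpleGraph V) [DecidableRel G.Adj] (W J : Finset V) : Finset V :=
  W.filter (fun w => ∀ a ∈ J, ¬ G.Adj a w)

theorem mem_NW {W J : Finset V} {w : V} : w ∈ NW G W J ↔ w ∈ W ∧ ∃ a ∈ J, G.Adj a w := by
  simp [NW]
theorem mem_NO {W J : Finset V} {w : V} : w ∈ NO G W J ↔ w ∈ W ∧ ∀ a ∈ J, ¬ G.Adj a w := by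
  simp [NO]

theorem card_NWO {W J : Finset V} : (NW G W J).card + (NO G W J).card = W.card := by
  have := Finset.card_filter_add_card_filter_not (s := W) (fun w => ∃ a ∈ J, G.Adj a w)
  have h2 : NO G W J = W.filter (fun w => ¬ ∃ a ∈ J, G.Adj a w) := by
    ext w; simp [NO]
  rw [h2]; exact this

/-- neighbours in L2 of a first neighbour -/
theorem NN_first (hG : CG G) {U : Finset V} {v a : V} (ha : a ∈ NN G U v) {x : V}
    (hx : x ∈ NN G U a) : x = v ∨ x ∈ L2 G U v := by
  rw [mem_NN] at *
  by_cases h : x = v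
  · exact Or.inl h
  · refine Or.inr (mem_L2.2 ⟨mem_BB.2 ⟨hx.1, h, fun h2 => hG.tf _ _ _ ha.2 hx.2 h2⟩, a, ?_⟩)
    rw [mem_SS, mem_NN]
    exact ⟨ha, hx.2⟩

theorem bu_first (hG : CG G) {U J : Finset V} {v : V} (hJ : J ⊆ NN G U v) :
    (J.biUnion (NN G U)).card ≤ (NW G (L2 G U v) J).card + 1 := by
  rw [← Finset.card_singleton v]
  refine (Finset.card_le_card ?_).trans (Finset.card_union_le _ _)
  intro x hx
  rw [Finset.mem_biUnion] at hx
  obtain ⟨a, ha, hx⟩ := hx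
  rw [Finset.mem_union, Finset.mem_singleton, mem_NW]
  rcases NN_first hG (hJ ha) hx with h | h
  · exact Or.inr h
  · exact Or.inl ⟨h, a, ha, (mem_NN.1 hx).2⟩

theorem NW_one {U : Finset V} {v a : V} (hv : v ∈ U) (ha : a ∈ NN G U v) :
    (NW G (L2 G U v) {a}).card + 1 ≤ (NN G U a).card := by
  have h1 : v ∉ NW G (L2 G U v) {a} := by
    intro h
    have := (mem_BB.1 (mem_L2.1 (mem_NW.1 h).1).1).2.1
    exact this rfl
  rw [← Finset.card_insert_of_notMem h1]
  apply Finset.card_le_card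
  intro x hx
  rw [Finset.mem_insert] at hx
  rw [mem_NN]
  rcases hx with rfl | hx
  · exact ⟨hv, (mem_NN.1 ha).2.symm⟩
  · rw [mem_NW] at hx
    obtain ⟨h2, b, hb, h3⟩ := hx
    rw [Finset.mem_singleton] at hb
    subst hb
    exact ⟨(mem_BB.1 (mem_L2.1 h2).1).1, h3⟩

theorem NW_le {W J : Finset V} {m : ℕ} (h : ∀ a ∈ J, (NW G W {a}).card ≤ m) :
    (NW G W J).card ≤ J.card * m := by
  have : NW G W J = J.biUnion (fun a => NW G W {a}) := by
    ext w
    simp only [mem_NW, Finset.mem_biUnion, Finset.mem_singleton]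
    constructor
    · rintro ⟨h1, a, h2, h3⟩
      exact ⟨a, h2, h1, a, rfl, h3⟩
    · rintro ⟨a, h2, h1, b, rfl, h3⟩
      exact ⟨h1, b, h2, h3⟩
  rw [this]
  exact Finset.card_biUnion_le_card_mul _ _ _ h

/-- label double count -/
theorem dbl {A W : Finset V} (hW : ∀ w ∈ W, (SS G A w).Nonempty) :
    2 * W.card ≤ ∑ a ∈ A, ((NW G W {a}).card + (NO G W (A.erase a)).card) := by
  have h1 : ∀ a ∈ A, ((NW G W {a}).card + (NO G W (A.erase a)).card) = 
      ∑ w ∈ W, ((if G.Adj a w then 1 else 0) + 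
        (if ∀ b ∈ A.erase a, ¬ G.Adj b w then 1 else 0)) := by
    intro a _
    rw [Finset.sum_add_distrib, NW, NO, Finset.card_filter, Finset.card_filter]
    simp
  rw [Finset.sum_congr rfl h1, Finset.sum_comm, mul_comm]
  rw [← smul_eq_mul]
  apply Finset.card_nsmul_le_sum
  intro w hw
  obtain ⟨a, ha⟩ := hW w hw
  rw [mem_SS] at ha
  by_cases h : ∃ b ∈ A, b ≠ a ∧ G.Adj b w
  · obtain ⟨b, hb, hne, hbw⟩ := h
    calc 2 = ∑ x ∈ ({a, b} : Finset V), 1 := by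
          rw [Finset.sum_const, Finset.card_pair hne.symm]; rfl
      _ ≤ ∑ x ∈ ({a, b} : Finset V), ((if G.Adj x w then 1 else 0) + 
        (if ∀ b ∈ A.erase x, ¬ G.Adj b w then 1 else 0)) := by
          apply Finset.sum_le_sum
          intro x hx
          have : G.Adj x w := by
            rw [Finset.mem_insert, Finset.mem_singleton] at hx
            rcases hx with rfl | rfl
            · exact ha.2
            · exact hbw
          rw [if_pos this]; omega
      _ ≤ _ := by
          apply Finset.sum_le_sum_of_subset
          intro x hx
          rw [Finset.mem_insert, Finset.mem_singleton] at hx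
          rcases hx with rfl | rfl
          · exact ha.1
          · exact hb
  · push Not at h
    refine le_trans ?_ (Finset.single_le_sum (fun _ _ => Nat.zero_le _) ha.1)
    rw [if_pos ha.2, if_pos]
    intro b hb
    rw [Finset.mem_erase] at hb
    exact h b hb.2 hb.1

theorem deg4 (hG : CG G) {U : Finset V} (hU : U.card = 26) (h : IRle G U 8)
    (hD : ∀ x ∈ U, (NN G U x).card ≤ 4) {v : V} (hv : v ∈ U) (hd : (NN G U v).card = 4) :
    False := by
  set A := NN G U v with hA
  set W := L2 G U v with hW
  have hAU : A ⊆ U := Finset.filter_subset _ _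
  have hBU : BB G U v ⊆ U := Finset.filter_subset _ _
  have hWU : W ⊆ U := (Finset.filter_subset _ _).trans hBU
  have hLU : L3 G U v ⊆ U := (Finset.filter_subset _ _).trans hBU
  have c1 : U.card = 1 + A.card + (BB G U v).card := card_BB (G := G) hv
  have c2 : (BB G U v).card = W.card + (L3 G U v).card := card_L23 (G := G) (U := U) (v := v)
  have hone : ∀ a ∈ A, (NW G W {a}).card ≤ 3 := by
    intro a ha
    have : (NW G W {a}).card + 1 ≤ (NN G U a).card := NW_one hv ha
    have := hD a (hAU ha)
    omega
  have hthree : ∀ a ∈ A, 8 ≤ (NW G W (A.erase a)).card ∧ (NW G W (A.erase a)).card ≤ 9 := by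
    intro a ha
    have e1 : (A.erase a).card = 3 := by rw [Finset.card_erase_of_mem ha]; omega
    have e2 : A.erase a ⊆ A := Finset.erase_subset _ _
    have e3 : Ind G (A.erase a) := fun x hx y hy => NN_ind hG x (e2 hx) y (e2 hy)
    have e4 := g5 hG (RR_IR (j := 5) h e3 (e2.trans hAU) (by omega))
    have e5 := RR_card (G := G) (U := U) (I := A.erase a)
    have e6 : _ ≤ (NW G W (A.erase a)).card + 1 := bu_first hG e2
    have e7 := NW_le (G := G) (W := W) (J := A.erase a) (m := 3) (fun b hb => hone b (e2 hb))
    rw [e1] at e7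
    constructor <;> omega
  have hCind : ∀ a ∈ A, Ind G (A.erase a ∪ NO G W (A.erase a)) := by
    intro a ha x hx y hy hxy
    rw [Finset.mem_union, mem_NO] at hx hy
    have key : ∀ z, z ∈ W → (∀ b ∈ A.erase a, ¬ G.Adj b z) → G.Adj a z := by
      intro z hz hz2
      obtain ⟨b, hb⟩ := (mem_L2.1 hz).2
      rw [mem_SS] at hb
      by_cases hba : b = a
      · exact hba ▸ hb.2
      · exact absurd hb.2 (hz2 b (Finset.mem_erase.2 ⟨hba, hb.1⟩))
    rcases hx with hx | hx <;> rcases hy with hy | hy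
    · exact NN_ind hG x (Finset.mem_of_mem_erase hx) y (Finset.mem_of_mem_erase hy) hxy
    · exact hy.2 x hx hxy
    · exact hx.2 y hy hxy.symm
    · exact hG.tf _ _ _ (key x hx.1 hx.2) hxy (key y hy.1 hy.2)
  have hAW : ∀ x ∈ A, x ∉ W := by
    intro x hx hx2
    exact (mem_BB.1 (mem_L2.1 hx2).1).2.2 (mem_NN.1 hx).2
  have hCcard : ∀ a ∈ A, (A.erase a ∪ NO G W (A.erase a)).card = 3 + (NO G W (A.erase a)).card := by
    intro a ha
    have e1 : (A.erase a).card = 3 := by rw [Finset.card_erase_of_mem ha]; omega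
    rw [Finset.card_union_of_disjoint, e1]
    rw [Finset.disjoint_left]
    intro x hx hx2
    exact hAW x (Finset.mem_of_mem_erase hx) (mem_NO.1 hx2).1
  have hZ : ∀ a ∈ A, ∀ k, 5 ≤ k + (NO G W (A.erase a)).card → 
      IRle G (NO G (L3 G U v) (NO G W (A.erase a))) k := by
    intro a ha k hk
    apply cover (I := A.erase a ∪ NO G W (A.erase a)) k h (hCind a ha)
    · exact Finset.union_subset ((Finset.erase_subset _ _).trans hAU)
        ((Finset.filter_subset _ _).trans hWU)
    · exact (Finset.filter_subset _ _).trans hLU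
    · intro w hw
      rw [mem_NO] at hw
      have h3 := mem_L3.1 hw.1
      refine ⟨fun hh => ?_, fun i hi => ?_⟩
      · rw [Finset.mem_union] at hh
        rcases hh with hh | hh
        · exact (mem_BB.1 h3.1).2.2 (mem_NN.1 (Finset.mem_of_mem_erase hh)).2
        · exact (Finset.mem_filter.1 hw.1).2 (mem_L2.1 (mem_NO.1 hh).1).2
      · rw [Finset.mem_union] at hi
        rcases hi with hi | hi
        · exact h3.2 i (Finset.mem_of_mem_erase hi)
        · exact hw.2 i hi
    · rw [hCcard a ha]; omega
  have hdis : ∑ a ∈ A, (NW G (L3 G U v) (NO G W (A.erase a))).card ≤ (L3 G U v).card := by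
    rw [← Finset.card_biUnion]
    · apply Finset.card_le_card
      intro x hx
      rw [Finset.mem_biUnion] at hx
      obtain ⟨a, _, hx⟩ := hx
      exact (mem_NW.1 hx).1
    · intro a ha b hb hab
      rw [Function.onFun, Finset.disjoint_left]
      intro x hx hy
      rw [mem_NW] at hx hy
      obtain ⟨hx1, c, hc, hcx⟩ := hx
      obtain ⟨_, d, hd, hdx⟩ := hy
      rw [mem_NO] at hc hd
      have hS := sec_L2 (G := G) (U := U) (v := v)
      obtain ⟨e, he1, he2⟩ := R1' hG hS.1 (mem_BB.1 (mem_L3.1 hx1).1).2.2 hcx.symm hdx.symm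
        (hS.2 c hc.1).2 (hS.2 d hd.1).2
      rw [mem_SS] at he1 he2
      by_cases hea : e = a
      · exact hd.2 e (Finset.mem_erase.2 ⟨hea ▸ hab, he2.1⟩) he2.2
      · exact hc.2 e (Finset.mem_erase.2 ⟨hea, he1.1⟩) he1.2
  have hdbl := dbl (G := G) (A := A) (W := W) (fun w hw => (mem_L2.1 hw).2)
  obtain ⟨a, b, c, d, hab, hac, had, hbc, hbd, hcd, hAe⟩ := Finset.card_eq_four.1 hd
  have ma : a ∈ A := by rw [hAe]; simp
  have mb : b ∈ A := by rw [hAe]; simp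
  have mc : c ∈ A := by rw [hAe]; simp
  have md : d ∈ A := by rw [hAe]; simp
  have hsum : ∀ f : V → ℕ, ∑ x ∈ A, f x = f a + f b + f c + f d := by
    intro f
    rw [hAe, Finset.sum_insert, Finset.sum_insert, Finset.sum_insert, Finset.sum_singleton]
    · omega
    · simp [hcd]
    · simp [hbc, hbd]
    · simp [hab, hac, had]
  rw [hsum] at hdis hdbl
  have hall : ∀ x ∈ A, (NW G (L3 G U v) (NO G W (A.erase x))).card + 7 ≥ (L3 G U v).card ∨ 
      (NO G W (A.erase x)).card ≤ 1 := by
    intro x hx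
    by_cases h2 : 2 ≤ (NO G W (A.erase x)).card
    · have := g3 hG (hZ x hx 3 (by omega))
      have := card_NWO (G := G) (W := L3 G U v) (J := NO G W (A.erase x))
      left; omega
    · right; omega
  have hall3 : ∀ x ∈ A, 3 ≤ (NO G W (A.erase x)).card → 
      (NW G (L3 G U v) (NO G W (A.erase x))).card + 5 ≥ (L3 G U v).card := by
    intro x hx h2
    have := g2 hG (hZ x hx 2 (by omega))
    have := card_NWO (G := G) (W := L3 G U v) (J := NO G W (A.erase x))
    omega
  have hs3 : ∀ x ∈ A, (NO G W (A.erase x)).card ≤ 3 := by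
    intro x hx
    refine le_trans (Finset.card_le_card ?_) (hone x hx)
    intro z hz
    rw [mem_NO] at hz
    rw [mem_NW]
    refine ⟨hz.1, x, by simp, ?_⟩
    obtain ⟨b, hb⟩ := (mem_L2.1 hz.1).2
    rw [mem_SS] at hb
    by_cases hba : b = x
    · exact hba ▸ hb.2
    · exact absurd hb.2 (hz.2 b (Finset.mem_erase.2 ⟨hba, hb.1⟩))
  have t1 := card_NWO (G := G) (W := W) (J := A.erase a)
  have t2 := card_NWO (G := G) (W := W) (J := A.erase b)
  have t3 := card_NWO (G := G) (W := W) (J := A.erase c)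
  have t4 := card_NWO (G := G) (W := W) (J := A.erase d)
  have o1 := hone a ma
  have o2 := hone b mb
  have o3 := hone c mc
  have o4 := hone d md
  have r1 := hthree a ma
  have r2 := hthree b mb
  have r3 := hthree c mc
  have r4 := hthree d md
  have u1 := hs3 a ma
  have u2 := hs3 b mb
  have u3 := hs3 c mc
  have u4 := hs3 d md
  have p1 := hall a ma
  have p2 := hall b mb
  have p3 := hall c mc
  have p4 := hall d md
  have q1 := hall3 a ma
  have q2 := hall3 b mb
  have q3 := hall3 c mc
  have q4 := hall3 d md
  clear hall hall3 hs3 hthree hone hZ hCind hCcard hsum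
  have hw : W.card = 10 ∨ W.card = 11 ∨ W.card = 12 := by
    clear p1 p2 p3 p4 q1 q2 q3 q4 hdis
    omega
  have w1 : 2 ≤ (NO G W (A.erase a)).card := by
    clear p1 p2 p3 p4 q1 q2 q3 q4 hdis
    omega
  have w2 : 2 ≤ (NO G W (A.erase b)).card := by
    clear p1 p2 p3 p4 q1 q2 q3 q4 hdis
    omega
  have w3 : 2 ≤ (NO G W (A.erase c)).card := by
    clear p1 p2 p3 p4 q1 q2 q3 q4 hdis
    omega
  have w4 : 2 ≤ (NO G W (A.erase d)).card := by
    clear p1 p2 p3 p4 q1 q2 q3 q4 hdis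
    omega
  replace p1 := p1.resolve_right (by omega)
  replace p2 := p2.resolve_right (by omega)
  replace p3 := p3.resolve_right (by omega)
  replace p4 := p4.resolve_right (by omega)
  rcases hw with hw | hw | hw
  · clear q1 q2 q3 q4
    omega
  · clear q1 q2 q3 q4
    omega
  · replace q1 := q1 (by omega)
    replace q2 := q2 (by omega)
    replace q3 := q3 (by omega)
    replace q4 := q4 (by omega)
    omega

theorem partII (hG : CG G) {U : Finset V} (hU : U.card = 26) (h : IRle G U 8)
    (hD : ∀ x ∈ U, (NN G U x).card ≤ 4) : False := by
  have hD3 : ∀ x ∈ U, (NN G U x).card ≤ 3 := by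
    intro x hx
    have := hD x hx
    by_contra hc
    exact deg4 hG hU h hD hx (by omega)
  have hD2 : ∀ x ∈ U, (NN G U x).card ≤ 2 := by
    intro x hx
    have := hD3 x hx
    by_contra hc
    have e4 := g5 hG (RR_IR (j := 5) h (NN_ind hG (v := x)) (Finset.filter_subset _ _) (by omega))
    have e5 := RR_card (G := G) (U := U) (I := NN G U x)
    have e6 := bu_first hG (U := U) (J := NN G U x) (v := x) (Finset.Subset.refl _)
    have e7 := NW_le (G := G) (W := L2 G U x) (J := NN G U x) (m := 2) (fun b hb => by
      have := NW_one hx hb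
      have := hD3 b (mem_NN.1 hb).1
      omega)
    have e8 : (NN G U x).card = 3 := by omega
    rw [e8] at e7 e5
    omega
  obtain ⟨I, hI, hi, hc⟩ := ex_ind3 hG (by omega : 6 ≤ U.card)
  have e4 := g5 hG (RR_IR (j := 5) h hi hI (by omega))
  have e5 := RR_card (G := G) (U := U) (I := I)
  have e6 := Finset.card_biUnion_le_card_mul I (NN G U) 2 (fun x hx => hD2 x (hI hx))
  omega

end IRR

namespace IRR
open Finset

variable {V : Type*} [DecidableEq V] {G : SimpleGraph V} [DecidableRel G.Adj]

def Wk (G : SimpleGraph V) (W : Finset V) (n : ℕ) (x z : V) : Prop :=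
  ∃ f : ℕ → V, f 0 = x ∧ f n = z ∧ (∀ i ≤ n, f i ∈ W) ∧ ∀ i < n, G.Adj (f i) (f (i+1))

theorem Wk.refl {W : Finset V} {x : V} (hx : x ∈ W) : Wk G W 0 x x :=
  ⟨fun _ => x, rfl, rfl, fun _ _ => hx, fun i hi => absurd hi (by omega)⟩

theorem Wk.snoc {W : Finset V} {n : ℕ} {x z w : V} (h : Wk G W n x z) (hw : w ∈ W)
    (hzw : G.Adj z w) : Wk G W (n+1) x w := by
  obtain ⟨f, h0, hn, hm, ha⟩ := h
  refine ⟨fun i => if i ≤ n then f i else w, by simpa using h0, by simp, ?_, ?_⟩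
  · intro i _
    dsimp only
    split_ifs with h
    · exact hm i h
    · exact hw
  · intro i hi
    dsimp only
    rw [if_pos (by omega : i ≤ n)]
    split_ifs with h
    · exact ha i (by omega)
    · have : i = n := by omega
      rw [this, hn]; exact hzw

theorem wk_short {W : Finset V} {n : ℕ} {f : ℕ → V}
    (hm : ∀ i ≤ n, f i ∈ W) (ha : ∀ i < n, G.Adj (f i) (f (i+1))) {i : ℕ} (hi : i + 3 ≤ n)
    (h3 : G.Adj (f i) (f (i+3))) : Wk G W (n-2) (f 0) (f n) := by
  refine ⟨fun j => if j ≤ i then f j else f (j+2), by simp, ?_, ?_, ?_⟩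
  · dsimp only
    rw [if_neg (by omega)]
    congr 1; omega
  · intro j hj
    dsimp only
    split_ifs with h
    · exact hm _ (by omega)
    · exact hm _ (by omega)
  · intro j hj
    dsimp only
    split_ifs with h h' h'
    · exact ha _ (by omega)
    · have : j = i := by omega
      subst this; exact h3
    · omega
    · exact ha _ (by omega)

theorem dstar (hG : CG G) {v : V} {A W : Finset V} (hS : Sec G v A W) :
    ∀ m x z, Wk G W (2*m) x z → ∃ d ∈ W, SS G A x ⊆ SS G A d ∧ SS G A z ⊆ SS G A d := by
  intro m
  induction m with
  | zero =>
    rintro x z ⟨f, h0, hn, hm, ha⟩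
    have : x = z := by rw [← h0, ← hn]
    subst this
    exact ⟨x, h0 ▸ hm 0 (by omega), Finset.Subset.refl _, Finset.Subset.refl _⟩
  | succ m ih =>
    rintro x z ⟨f, h0, hn, hm, ha⟩
    by_cases hs : ∃ i, i + 3 ≤ 2*(m+1) ∧ G.Adj (f i) (f (i+3))
    · obtain ⟨i, hi, h3⟩ := hs
      have := wk_short hm ha hi h3
      rw [h0, hn] at this
      exact ih x z this
    push Not at hs
    subst h0 hn
    by_cases h1 : m = 0
    · subst h1
      have m0 := hm 0 (by omega)
      have m1 := hm 1 (by omega)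
      have m2 := hm 2 (by omega)
      rcases R1 hG hS.1 (hS.2 _ m1).1 (ha 0 (by omega)).symm (ha 1 (by omega)) with h | h
      · exact ⟨f 2, m2, h, Finset.Subset.refl _⟩
      · exact ⟨f 0, m0, Finset.Subset.refl _, h⟩
    by_cases h2 : m = 1
    · subst h2
      have p := peak hG hS (ha 0 (by omega)) (ha 1 (by omega)) (ha 2 (by omega)) (ha 3 (by omega))
        (hs 0 (by omega)) (hs 1 (by omega)) (hm _ (by omega)) (hm _ (by omega)) (hm _ (by omega))
        (hm _ (by omega)) (hm _ (by omega))
      exact ⟨_, hm 2 (by omega), p.1, p.2⟩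
    · exact (two_peaks hG hS f (fun i hi => hm i (by omega)) (fun i hi => ha i (by omega))
        (fun i hi => hs i (by omega))).elim

theorem ind_union {X Y : Finset V} (hX : Ind G X) (hY : Ind G Y)
    (h : ∀ x ∈ X, ∀ y ∈ Y, ¬ G.Adj x y) : Ind G (X ∪ Y) := by
  intro x hx y hy hxy
  rw [Finset.mem_union] at hx hy
  rcases hx with hx | hx <;> rcases hy with hy | hy
  · exact hX x hx y hy hxy
  · exact h x hx y hy hxy
  · exact h y hy x hx hxy.symm
  · exact hY x hx y hy hxy

theorem bip_cls {W : Finset V} {y : V} (hyW : y ∉ W) (h : Bip G (insert y W)) :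
    ∃ P Q : Finset V, P ⊆ W ∧ Q ⊆ W ∧ Disjoint P Q ∧ P ∪ Q = W ∧ Ind G P ∧ Ind G (insert y Q) := by
  obtain ⟨c, hc⟩ := h
  refine ⟨W.filter (fun w => c w ≠ c y), W.filter (fun w => c w = c y), 
    Finset.filter_subset _ _, Finset.filter_subset _ _, ?_, ?_, ?_, ?_⟩
  · rw [Finset.disjoint_left]
    intro x hx hy
    rw [Finset.mem_filter] at hx hy
    exact hx.2 hy.2
  · ext x
    simp only [Finset.mem_union, Finset.mem_filter]
    tauto
  · intro x hx z hz hxz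
    rw [Finset.mem_filter] at hx hz
    have := hc x (by simp [hx.1]) z (by simp [hz.1]) hxz
    have h1 := hx.2
    have h2 := hz.2
    revert this h1 h2
    cases c x <;> cases c z <;> cases c y <;> simp
  · have key : ∀ x ∈ insert y (W.filter (fun w => c w = c y)), x ∈ insert y W ∧ c x = c y := by
      intro x hx
      rw [Finset.mem_insert, Finset.mem_filter] at hx
      rcases hx with rfl | hx
      · simp
      · simp [hx.1, hx.2]
    intro x hx z hz hxz
    exact hc x (key x hx).1 z (key z hz).1 hxz ((key x hx).2.trans (key z hz).2.symm)

theorem reach {W B : Finset V} {y1 y2 : V} (hWB : W ⊆ B) (hW : W.card = 13)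
    (hB : ∀ X ⊆ B, Ind G X → X.card ≤ 7) (h1 : y1 ∈ B) (h2 : y2 ∈ B) (h1W : y1 ∉ W)
    (h2W : y2 ∉ W) (b1 : Bip G (insert y1 W)) (b2 : Bip G (insert y2 W)) :
    ∃ d1 ∈ W, ∃ d2 ∈ W, G.Adj y1 d1 ∧ G.Adj y2 d2 ∧ ∃ m, Wk G W (2*m) d1 d2 := by
  classical
  by_contra hcon
  push Not at hcon
  set E := W.filter (fun z => ∃ d ∈ W, G.Adj y1 d ∧ ∃ m, Wk G W (2*m) d z) with hE
  set O := W.filter (fun z => ∃ d ∈ W, G.Adj y1 d ∧ ∃ m, Wk G W (2*m+1) d z) with hO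
  have hEW : E ⊆ W := Finset.filter_subset _ _
  have hOW : O ⊆ W := Finset.filter_subset _ _
  have hyE : ∀ z ∈ W, G.Adj y1 z → z ∈ E := fun z hz h =>
    Finset.mem_filter.2 ⟨hz, z, hz, h, 0, Wk.refl hz⟩
  have hEO : ∀ z ∈ E, ∀ w ∈ W, G.Adj z w → w ∈ O := by
    intro z hz w hw hzw
    obtain ⟨_, d, hd, hyd, m, hm⟩ := Finset.mem_filter.1 hz
    exact Finset.mem_filter.2 ⟨hw, d, hd, hyd, m, hm.snoc hw hzw⟩
  have hOE : ∀ z ∈ O, ∀ w ∈ W, G.Adj z w → w ∈ E := by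
    intro z hz w hw hzw
    obtain ⟨_, d, hd, hyd, m, hm⟩ := Finset.mem_filter.1 hz
    exact Finset.mem_filter.2 ⟨hw, d, hd, hyd, m+1, hm.snoc hw hzw⟩
  have hy2 : ∀ z ∈ E, ¬ G.Adj y2 z := by
    intro z hz h
    obtain ⟨hzW, d, hd, hyd, m, hm⟩ := Finset.mem_filter.1 hz
    exact hcon d hd z hzW hyd h m hm
  obtain ⟨P, Q, hP, hQ, hPQ, hPQW, hPi, hQi⟩ := bip_cls h1W b1
  obtain ⟨P2, Q2, hP2, hQ2, hPQ2, hPQW2, hPi2, hQi2⟩ := bip_cls h2W b2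
  -- colours of walks
  have hcol : ∀ n d z, d ∈ W → G.Adj y1 d → Wk G W n d z → (Even n → z ∈ P) ∧ (¬ Even n → z ∈ Q) := by
    rintro n d z hd hyd ⟨f, h0, hn, hm, ha⟩
    have side : ∀ w ∈ W, w ∈ P ∨ w ∈ Q := by
      intro w hw; rw [← hPQW, Finset.mem_union] at hw; exact hw
    have : ∀ i ≤ n, (Even i → f i ∈ P) ∧ (¬ Even i → f i ∈ Q) := by
      intro i
      induction i with
      | zero =>
        intro _
        refine ⟨fun _ => ?_, fun h => absurd (by simp) h⟩
        rw [h0]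
        rcases side d hd with h | h
        · exact h
        · exact absurd hyd (hQi y1 (by simp) d (by simp [h]))
      | succ i ih =>
        intro hi
        have ih := ih (by omega)
        have had := ha i (by omega)
        rw [Nat.even_add_one, not_not]
        refine ⟨fun he => ?_, fun he => ?_⟩
        · rcases side _ (hm _ hi) with h | h
          · exact h
          · exact absurd had (hQi _ (by simp [ih.2 he]) _ (by simp [h]))
        · rcases side _ (hm _ hi) with h | h
          · exact absurd had (hPi _ (ih.1 he) _ h)
          · exact h
    rw [← hn]; exact this n le_rfl
  have hEP : E ⊆ P := by
    intro z hz
    obtain ⟨_, d, hd, hyd, m, hm⟩ := Finset.mem_filter.1 hz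
    exact (hcol _ d z hd hyd hm).1 (by simp)
  have hOQ : O ⊆ Q := by
    intro z hz
    obtain ⟨_, d, hd, hyd, m, hm⟩ := Finset.mem_filter.1 hz
    exact (hcol _ d z hd hyd hm).2 (by simp [Nat.even_add_one])
  have hEi : Ind G E := fun x hx y hy => hPi x (hEP hx) y (hEP hy)
  have hOi : Ind G (insert y1 O) := fun x hx y hy => 
    hQi x (Finset.insert_subset_insert _ hOQ hx) y (Finset.insert_subset_insert _ hOQ hy)
  have hEOd : Disjoint E O := Finset.disjoint_of_subset_left hEP (Finset.disjoint_of_subset_right hOQ hPQ)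
  have cPQ : P.card + Q.card = 13 := by rw [← Finset.card_union_of_disjoint hPQ, hPQW, hW]
  have cQ := hB (insert y1 Q) (Finset.insert_subset h1 (hQ.trans hWB)) hQi
  rw [Finset.card_insert_of_notMem (fun h => h1W (hQ h))] at cQ
  have s1 := hB (insert y1 O ∪ (P \ E)) 
    (Finset.union_subset (Finset.insert_subset h1 (hOW.trans hWB)) 
      (Finset.sdiff_subset.trans (hP.trans hWB))) (by
      apply ind_union hOi
      · intro x hx y hy
        exact hPi x (Finset.mem_sdiff.1 hx).1 y (Finset.mem_sdiff.1 hy).1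
      · intro x hx y hy hxy
        rw [Finset.mem_sdiff] at hy
        rw [Finset.mem_insert] at hx
        rcases hx with rfl | hx
        · exact hy.2 (hyE y (hP hy.1) hxy)
        · exact hy.2 (hOE x hx y (hP hy.1) hxy))
  rw [Finset.card_union_of_disjoint, Finset.card_insert_of_notMem (fun h => h1W (hOW h)),
    Finset.card_sdiff_of_subset hEP] at s1
  swap
  · rw [Finset.disjoint_left]
    intro x hx hy
    rw [Finset.mem_sdiff] at hy
    rw [Finset.mem_insert] at hx
    rcases hx with rfl | hx
    · exact h1W (hP hy.1)
    · exact Finset.disjoint_left.1 hPQ hy.1 (hOQ hx)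
  have hEPc := Finset.card_le_card hEP
  have s2 := hB (E ∪ (P2 \ (E ∪ O))) (Finset.union_subset (hEW.trans hWB) 
      (Finset.sdiff_subset.trans (hP2.trans hWB))) (by
      apply ind_union hEi
      · intro x hx y hy
        exact hPi2 x (Finset.mem_sdiff.1 hx).1 y (Finset.mem_sdiff.1 hy).1
      · intro x hx y hy hxy
        rw [Finset.mem_sdiff] at hy
        exact hy.2 (Finset.mem_union_right _ (hEO x hx y (hP2 hy.1) hxy)))
  have s3 := hB (E ∪ insert y2 (Q2 \ (E ∪ O))) (Finset.union_subset (hEW.trans hWB) 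
      (Finset.insert_subset h2 (Finset.sdiff_subset.trans (hQ2.trans hWB)))) (by
      apply ind_union hEi
      · intro x hx y hy
        exact hQi2 x (Finset.insert_subset_insert _ Finset.sdiff_subset hx) y 
          (Finset.insert_subset_insert _ Finset.sdiff_subset hy)
      · intro x hx y hy hxy
        rw [Finset.mem_insert, Finset.mem_sdiff] at hy
        rcases hy with rfl | hy
        · exact hy2 x hx hxy.symm
        · exact hy.2 (Finset.mem_union_right _ (hEO x hx y (hQ2 hy.1) hxy)))
  rw [Finset.card_union_of_disjoint] at s2
  swap
  · rw [Finset.disjoint_left]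
    intro x hx hy
    exact (Finset.mem_sdiff.1 hy).2 (Finset.mem_union_left _ hx)
  rw [Finset.card_union_of_disjoint, Finset.card_insert_of_notMem] at s3
  rotate_left
  · intro h
    exact h2W (hQ2 (Finset.mem_sdiff.1 h).1)
  · rw [Finset.disjoint_left]
    intro x hx hy
    rw [Finset.mem_insert] at hy
    rcases hy with rfl | hy
    · exact h2W (hEW hx)
    · exact (Finset.mem_sdiff.1 hy).2 (Finset.mem_union_left _ hx)
  have s4 : W.card ≤ (P2 \ (E ∪ O)).card + (Q2 \ (E ∪ O)).card + (E.card + O.card) := by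
    rw [← Finset.card_union_of_disjoint hEOd]
    have : W ⊆ ((P2 \ (E ∪ O)) ∪ (Q2 \ (E ∪ O))) ∪ (E ∪ O) := by
      intro x hx
      rw [← hPQW2, Finset.mem_union] at hx
      simp only [Finset.mem_union, Finset.mem_sdiff]
      tauto
    calc W.card ≤ _ := Finset.card_le_card this
      _ ≤ _ := (Finset.card_union_le _ _).trans (by gcongr; exact Finset.card_union_le _ _)
  omega

/-- dominating label -/
theorem exM (hG : CG G) {v y : V} {A W : Finset V} (hS : Sec G v A W) (hy : ¬ G.Adj v y)
    (h : ∃ d ∈ W, G.Adj y d) : ∃ a ∈ A, ∀ w ∈ W, G.Adj y w → G.Adj a w := by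
  obtain ⟨d, hd, hyd⟩ := h
  obtain ⟨m, hm, hmin⟩ := Finset.exists_min_image (W.filter (fun w => G.Adj y w)) 
    (fun w => (SS G A w).card) ⟨d, Finset.mem_filter.2 ⟨hd, hyd⟩⟩
  rw [Finset.mem_filter] at hm
  obtain ⟨a, ha⟩ := (hS.2 m hm.1).2
  refine ⟨a, (mem_SS.1 ha).1, fun w hw hyw => ?_⟩
  have h1 := hmin w (Finset.mem_filter.2 ⟨hw, hyw⟩)
  rcases R1 hG hS.1 hy hm.2 hyw with h | h
  · exact (mem_SS.1 (h ha)).2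
  · have := Finset.eq_of_subset_of_card_le h h1
    rw [← this] at ha
    exact (mem_SS.1 ha).2

end IRR

namespace IRR
open Finset

variable {V : Type*} [DecidableEq V] {G : SimpleGraph V} [DecidableRel G.Adj]

theorem two_of_five (hG : CG G) {Z : Finset V} (h : IRle G Z 2) (hZ : Z.card = 5) {x : V}
    (hx : x ∈ Z) : (NN G Z x).card = 2 := by
  have h1 := nonnb hG h hx
  have h2 := NN_le (v := x) hG h
  have h3 := card_BB (G := G) hx
  omega

theorem overlap {N1 N2 N3 : Finset V} (h1 : N1.card ≤ 4) (h2 : N2.card ≤ 4) (h3 : N3.card ≤ 4)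
    (hu : 10 ≤ (N1 ∪ N2 ∪ N3).card) {d12 d13 d23 : V} (a1 : d12 ∈ N1) (a2 : d12 ∈ N2)
    (b1 : d13 ∈ N1) (b3 : d13 ∈ N3) (c2 : d23 ∈ N2) (c3 : d23 ∈ N3) :
    N1.card = 4 ∧ N2.card = 4 ∧ N3.card = 4 ∧ (N1 ∪ N2 ∪ N3).card = 10 ∧
    ∃ d, d ∈ N1 ∧ d ∈ N2 ∧ d ∈ N3 ∧ ∀ w, (w ∈ N1 → w ∈ N2 → w = d) ∧ (w ∈ N1 → w ∈ N3 → w = d) ∧ 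
      (w ∈ N2 → w ∈ N3 → w = d) := by
  have e1 := Finset.card_union_add_card_inter N1 N2
  have e2 := Finset.card_union_add_card_inter (N1 ∪ N2) N3
  have i1 : 0 < (N1 ∩ N2).card := Finset.card_pos.2 ⟨d12, by simp [a1, a2]⟩
  have i2 : 0 < ((N1 ∪ N2) ∩ N3).card := Finset.card_pos.2 ⟨d13, by simp [b1, b3]⟩
  have j1 : (N1 ∩ N2).card ≤ 1 := by omega
  have j2 : ((N1 ∪ N2) ∩ N3).card ≤ 1 := by omega
  rw [Finset.card_le_one] at j1 j2
  have k1 : ∀ w, w ∈ N1 → w ∈ N2 → w = d12 := fun w h h' => 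
    j1 w (by simp [h, h']) d12 (by simp [a1, a2])
  have k2 : ∀ w, (w ∈ N1 ∨ w ∈ N2) → w ∈ N3 → w = d13 := fun w h h' => 
    j2 w (by simp [h, h']) d13 (by simp [b1, b3])
  have e : d23 = d13 := k2 d23 (Or.inr c2) c3
  subst e
  have e' : d23 = d12 := k1 d23 b1 c2
  subst e'
  exact ⟨by omega, by omega, by omega, by omega, d23, a1, a2, b3, fun w => 
    ⟨k1 w, fun h => k2 w (Or.inl h), fun h => k2 w (Or.inr h)⟩⟩

/-- structure of the leftover five vertices -/
theorem five (hG : CG G) {A4 R : Finset V} {p : V} (hI : IRle G (A4 ∪ R) 2) (hA : A4.card = 2)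
    (hR : R.card = 3) (hd : Disjoint A4 R) (hAi : Ind G A4) (hl : ∀ w ∈ R, ∃ a ∈ A4, G.Adj a w)
    (hp : p ∈ A4) : ∃ w4 ∈ R, ∃ w5 ∈ R, G.Adj w4 w5 ∧ G.Adj p w4 ∧ ¬ G.Adj p w5 ∧
      2 ≤ (NW G R {p}).card := by
  have hc : (A4 ∪ R).card = 5 := by rw [Finset.card_union_of_disjoint hd]; omega
  have hN : ∀ a ∈ A4, (NW G R {a}).card = 2 := by
    intro a ha
    rw [← two_of_five hG hI hc (Finset.mem_union_left _ ha)]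
    congr 1
    ext x
    simp only [mem_NW, mem_NN, Finset.mem_singleton, Finset.mem_union]
    constructor
    · rintro ⟨h1, b, rfl, h2⟩
      exact ⟨Or.inr h1, h2⟩
    · rintro ⟨h1 | h1, h2⟩
      · exact absurd h2 (hAi a ha x h1)
      · exact ⟨h1, a, rfl, h2⟩
  obtain ⟨q, hq⟩ : ∃ q, A4.erase p = {q} := by
    rw [← Finset.card_eq_one, Finset.card_erase_of_mem hp]; omega
  have hqA : q ∈ A4 ∧ q ≠ p := by
    have : q ∈ A4.erase p := by rw [hq]; simp
    rw [Finset.mem_erase] at this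
    exact ⟨this.2, this.1⟩
  have hpq : ∀ a ∈ A4, a = p ∨ a = q := by
    intro a ha
    by_cases h : a = p
    · exact Or.inl h
    · right
      have : a ∈ A4.erase p := Finset.mem_erase.2 ⟨h, ha⟩
      rw [hq] at this
      simpa using this
  -- a vertex of R adjacent to p but not q
  have hex : ∃ w ∈ NW G R {p}, w ∉ NW G R {q} := by
    by_contra hcon
    push Not at hcon
    have e1 : NW G R {p} = NW G R {q} := 
      Finset.eq_of_subset_of_card_le hcon (by rw [hN p hp, hN q hqA.1])
    have : R ⊆ NW G R {p} := by
      intro w hw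
      obtain ⟨a, ha, haw⟩ := hl w hw
      rcases hpq a ha with rfl | rfl
      · exact mem_NW.2 ⟨hw, a, by simp, haw⟩
      · rw [e1]; exact mem_NW.2 ⟨hw, a, by simp, haw⟩
    have := Finset.card_le_card this
    rw [hN p hp] at this
    omega
  obtain ⟨w4, h4, h4'⟩ := hex
  have h4R := (mem_NW.1 h4).1
  have h4p : G.Adj p w4 := by
    obtain ⟨_, b, hb, h⟩ := mem_NW.1 h4
    rw [Finset.mem_singleton] at hb
    exact hb ▸ h
  have h4q : ¬ G.Adj q w4 := fun h => h4' (mem_NW.2 ⟨h4R, q, by simp, h⟩)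
  have h2 := two_of_five hG hI hc (Finset.mem_union_right _ h4R)
  have hpm : p ∈ NN G (A4 ∪ R) w4 := mem_NN.2 ⟨Finset.mem_union_left _ hp, h4p.symm⟩
  obtain ⟨x, hx⟩ := Finset.card_pos.1 (by rw [Finset.card_erase_of_mem hpm]; omega : 
    0 < ((NN G (A4 ∪ R) w4).erase p).card)
  rw [Finset.mem_erase, mem_NN, Finset.mem_union] at hx
  obtain ⟨hxp, hxm, hxa⟩ := hx
  rcases hxm with hxm | hxm
  · rcases hpq x hxm with rfl | rfl
    · exact absurd rfl hxp
    · exact absurd hxa.symm h4q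
  · exact ⟨w4, h4R, x, hxm, hxa, h4p, hG.tf _ _ _ h4p hxa, (hN p hp).ge⟩

theorem deg5 (hG : CG G) {U : Finset V} (hU : U.card = 26) (h : IRle G U 8)
    (hD : ∀ x ∈ U, (NN G U x).card ≤ 5) {v : V} (hv : v ∈ U) (hd : (NN G U v).card = 5) :
    False := by
  obtain ⟨A, hA⟩ : ∃ A, A = NN G U v := ⟨_, rfl⟩
  obtain ⟨W, hW⟩ : ∃ W, W = L2 G U v := ⟨_, rfl⟩
  obtain ⟨L, hL⟩ : ∃ L, L = L3 G U v := ⟨_, rfl⟩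
  have hBU : BB G U v ⊆ U := Finset.filter_subset _ _
  have hAU : A ⊆ U := hA ▸ Finset.filter_subset _ _
  have hWB : W ⊆ BB G U v := hW ▸ Finset.filter_subset _ _
  have hLB : L ⊆ BB G U v := hL ▸ Finset.filter_subset _ _
  have hAi : Ind G A := hA ▸ NN_ind hG
  have hS : Sec G v A W := by subst hA hW; exact sec_L2
  have hLA : ∀ y ∈ L, ∀ a ∈ A, ¬ G.Adj a y := by
    intro y hy a ha
    subst hA hL
    exact (mem_L3.1 hy).2 a ha
  have hLv : ∀ y ∈ L, ¬ G.Adj v y := fun y hy => (mem_BB.1 (hLB hy)).2.2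
  have hAB : ∀ x ∈ A, x ∉ BB G U v := by
    intro x hx h2
    subst hA
    exact (mem_BB.1 h2).2.2 (mem_NN.1 hx).2
  have hLW : ∀ y ∈ L, y ∉ W := by
    intro y hy hy2
    subst hL hW
    exact (Finset.mem_filter.1 hy).2 (mem_L2.1 hy2).2
  have hAc : A.card = 5 := hA ▸ hd
  have hl3 : L.card ≤ 7 := by
    rw [hL]; exact g3 hG (L3_IR (v := v) (j := 3) hG h (by omega))
  have c1 := card_BB (G := G) hv
  have c2 := card_L23 (G := G) (U := U) (v := v)
  rw [← hW, ← hL] at c2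
  have hl2 : 0 < L.card → W.card + 1 ≤ 2 * 7 := by
    rw [hL, hW]; exact lemA' hG hv h (by omega)
  have hl2' : W.card ≤ 2 * 7 := by rw [hW]; exact lemA hG hv h (by omega)
  have hW13 : W.card = 13 := by omega
  have hL7 : L.card = 7 := by omega
  have hone : ∀ a ∈ A, (NW G W {a}).card ≤ 4 := by
    intro a ha
    have : (NW G W {a}).card + 1 ≤ (NN G U a).card := by
      subst hA hW; exact NW_one hv ha
    have := hD a (hAU ha)
    omega
  obtain ⟨Y, hYL, hYi, hYc⟩ := ex_ind3 hG (by omega : 6 ≤ L.card)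
  have hBI := BB_IR (j := 7) hv h (by omega)
  have hreach : ∀ y1 ∈ L, ∀ y2 ∈ L, 
      ∃ d1 ∈ W, ∃ d2 ∈ W, G.Adj y1 d1 ∧ G.Adj y2 d2 ∧ ∃ m, Wk G W (2*m) d1 d2 := by
    intro y1 h1 y2 h2
    exact reach hWB hW13 (fun X hX hi => ind_le hBI hi hX) (hLB h1) (hLB h2) (hLW _ h1) (hLW _ h2)
      (bip_insert hG hS (hLv _ h1)) (bip_insert hG hS (hLv _ h2))
  have hdom : ∀ y ∈ L, ∃ a ∈ A, ∀ w ∈ W, G.Adj y w → G.Adj a w := by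
    intro y hy
    obtain ⟨d1, h1, _, _, h2, _⟩ := hreach y hy y hy
    exact exM hG hS (hLv y hy) ⟨d1, h1, h2⟩
  have hdom' : ∃ f : V → V, ∀ y ∈ Y, f y ∈ A ∧ ∀ w ∈ W, G.Adj y w → G.Adj (f y) w := by
    have : ∀ y, ∃ a, y ∈ Y → a ∈ A ∧ ∀ w ∈ W, G.Adj y w → G.Adj a w := by
      intro y
      by_cases hy : y ∈ Y
      · obtain ⟨a, ha⟩ := hdom y (hYL hy)
        exact ⟨a, fun _ => ha⟩
      · exact ⟨y, fun h => absurd h hy⟩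
    choose f hf using this
    exact ⟨f, hf⟩
  obtain ⟨f, hf⟩ := hdom'
  -- covering lemma
  have hcov : ∀ J ⊆ A, Y.image f ⊆ J → ∀ j, 5 ≤ j + J.card → IRle G ((A \ J) ∪ NO G W J) j := by
    intro J hJ hYJ j hj
    have hJY : Disjoint J Y := by
      rw [Finset.disjoint_left]
      intro x hx hy
      exact hAB x (hJ hx) (hLB (hYL hy))
    apply cover (I := J ∪ Y) j h
    · exact ind_union (fun x hx y hy => hAi x (hJ hx) y (hJ hy)) hYi
        (fun x hx y hy => hLA y (hYL hy) x (hJ hx))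
    · exact Finset.union_subset (hJ.trans hAU) (hYL.trans (hLB.trans hBU))
    · exact Finset.union_subset (Finset.sdiff_subset.trans hAU)
        ((Finset.filter_subset _ _).trans (hWB.trans hBU))
    · intro w hw
      rw [Finset.mem_union, Finset.mem_sdiff, mem_NO] at hw
      rw [Finset.mem_union]
      rcases hw with hw | hw
      · refine ⟨?_, ?_⟩
        · rintro (h1 | h1)
          · exact hw.2 h1
          · exact hAB w hw.1 (hLB (hYL h1))
        · intro i hi
          rw [Finset.mem_union] at hi
          rcases hi with hi | hi
          · exact hAi i (hJ hi) w hw.1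
          · exact fun h => hLA i (hYL hi) w hw.1 h.symm
      · refine ⟨?_, ?_⟩
        · rintro (h1 | h1)
          · exact hAB w (hJ h1) (hWB hw.1)
          · exact hLW w (hYL h1) hw.1
        · intro i hi hiw
          rw [Finset.mem_union] at hi
          rcases hi with hi | hi
          · exact hw.2 i hi hiw
          · exact hw.2 (f i) (hYJ (Finset.mem_image_of_mem f hi)) ((hf i hi).2 w hw.1 hiw)
    · rw [Finset.card_union_of_disjoint hJY]; omega
  have hcovc : ∀ J ⊆ A, ((A \ J) ∪ NO G W J).card + J.card + (NW G W J).card = 18 := by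
    intro J hJ
    rw [Finset.card_union_of_disjoint, Finset.card_sdiff_of_subset hJ]
    · have := Finset.card_le_card hJ
      have := card_NWO (G := G) (W := W) (J := J)
      omega
    · rw [Finset.disjoint_left]
      intro x hx hy
      exact hAB x (Finset.mem_sdiff.1 hx).1 (hWB (mem_NO.1 hy).1)
  have himA : Y.image f ⊆ A := by
    intro x hx
    rw [Finset.mem_image] at hx
    obtain ⟨y, hy, rfl⟩ := hx
    exact (hf y hy).1
  have hT3 : (Y.image f).card = 3 := by
    by_contra hne
    have := Finset.card_image_le (s := Y) (f := f)
    obtain ⟨J, hJ1, hJ2, hJ3⟩ := Finset.exists_subsuperset_card_eq (n := 2) himA (by omega) (by omega)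
    have e1 := g3 hG (hcov J hJ2 hJ1 3 (by omega))
    have e2 := hcovc J hJ2
    have e3 := NW_le (G := G) (W := W) (J := J) (m := 4) (fun a ha => hone a (hJ2 ha))
    rw [hJ3] at e2 e3
    omega
  obtain ⟨T, hT⟩ : ∃ T, T = Y.image f := ⟨_, rfl⟩
  rw [← hT] at hT3 himA
  have hfT : ∀ y ∈ Y, f y ∈ T := fun y hy => hT ▸ Finset.mem_image_of_mem f hy
  have hTf : ∀ a ∈ T, ∃ y ∈ Y, f y = a := by
    intro a ha; rw [hT, Finset.mem_image] at ha; exact ha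
  have hinj : ∀ y ∈ Y, ∀ y' ∈ Y, f y = f y' → y = y' := by
    have : (Y.image f).card = Y.card := by rw [← hT]; omega
    intro y hy y' hy' he
    exact Finset.card_image_iff.1 this hy hy' he
  have hZ := hcov T himA (by rw [hT]) 2 (by omega)
  have hZ5 := g2 hG hZ
  have hZc := hcovc T himA
  have hpair : ∀ a ∈ T, ∀ b ∈ T, ∃ d ∈ W, G.Adj a d ∧ G.Adj b d := by
    intro a ha b hb
    obtain ⟨y, hy, rfl⟩ := hTf a ha
    obtain ⟨y', hy', rfl⟩ := hTf b hb
    obtain ⟨d1, h1, d2, h2, h3, h4, m, hm⟩ := hreach y (hYL hy) y' (hYL hy')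
    obtain ⟨d, hd, hd1, hd2⟩ := dstar hG hS m d1 d2 hm
    exact ⟨d, hd, (mem_SS.1 (hd1 (mem_SS.2 ⟨(hf y hy).1, (hf y hy).2 d1 h1 h3⟩))).2,
      (mem_SS.1 (hd2 (mem_SS.2 ⟨(hf y' hy').1, (hf y' hy').2 d2 h2 h4⟩))).2⟩
  -- overlap
  have hov : (∀ a ∈ T, (NW G W {a}).card = 4) ∧ (NW G W T).card = 10 ∧ ∃ d ∈ W, 
      (∀ a ∈ T, G.Adj a d) ∧ ∀ a ∈ T, ∀ b ∈ T, a ≠ b → ∀ w ∈ W, G.Adj a w → G.Adj b w → w = d := by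
    obtain ⟨a1, a2, a3, n12, n13, n23, hTe⟩ := Finset.card_eq_three.1 hT3
    have m1 : a1 ∈ T := by rw [hTe]; simp
    have m2 : a2 ∈ T := by rw [hTe]; simp
    have m3 : a3 ∈ T := by rw [hTe]; simp
    have mn : ∀ a w, w ∈ NW G W {a} ↔ w ∈ W ∧ G.Adj a w := by
      intro a w; simp [mem_NW]
    have hun : NW G W T = NW G W {a1} ∪ NW G W {a2} ∪ NW G W {a3} := by
      ext w
      simp only [Finset.mem_union, mn]
      rw [mem_NW, hTe]
      simp only [Finset.mem_insert, Finset.mem_singleton, exists_eq_or_imp, exists_eq_left]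
      tauto
    obtain ⟨d12, w12, p12, q12⟩ := hpair a1 m1 a2 m2
    obtain ⟨d13, w13, p13, q13⟩ := hpair a1 m1 a3 m3
    obtain ⟨d23, w23, p23, q23⟩ := hpair a2 m2 a3 m3
    obtain ⟨k1, k2, k3, ku, d, z1, z2, z3, hu⟩ := overlap (hone a1 (himA m1)) (hone a2 (himA m2))
      (hone a3 (himA m3)) (by rw [← hun]; omega) ((mn _ _).2 ⟨w12, p12⟩) ((mn _ _).2 ⟨w12, q12⟩)
      ((mn _ _).2 ⟨w13, p13⟩) ((mn _ _).2 ⟨w13, q13⟩) ((mn _ _).2 ⟨w23, p23⟩)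
      ((mn _ _).2 ⟨w23, q23⟩)
    rw [mn] at z1 z2 z3
    have hm3 : ∀ a ∈ T, a = a1 ∨ a = a2 ∨ a = a3 := by
      intro a ha; rw [hTe] at ha; simpa using ha
    refine ⟨?_, by rw [hun]; exact ku, d, z1.1, ?_, ?_⟩
    · intro a ha
      rcases hm3 a ha with rfl | rfl | rfl <;> assumption
    · intro a ha
      rcases hm3 a ha with rfl | rfl | rfl
      · exact z1.2
      · exact z2.2
      · exact z3.2
    · intro a ha b hb hab w hw haw hbw
      have ea := (mn a w).2 ⟨hw, haw⟩
      have eb := (mn b w).2 ⟨hw, hbw⟩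
      obtain ⟨u1, u2, u3⟩ := hu w
      rcases hm3 a ha with rfl | rfl | rfl <;> rcases hm3 b hb with rfl | rfl | rfl <;>
        first | exact absurd rfl hab | exact u1 ea eb | exact u1 eb ea | exact u2 ea eb
              | exact u2 eb ea | exact u3 ea eb | exact u3 eb ea
  obtain ⟨hT4, hT10, d, hdW, hdT, huniq⟩ := hov
  have hNOc := card_NWO (G := G) (W := W) (J := T)
  obtain ⟨p, hp⟩ := Finset.card_pos.1 (by rw [Finset.card_sdiff_of_subset himA]; omega : 
    0 < (A \ T).card)
  have hpA := (Finset.mem_sdiff.1 hp).1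
  have hpT := (Finset.mem_sdiff.1 hp).2
  obtain ⟨w4, h4, w5, h5, h45, hp4, hp5, hp2⟩ := five hG hZ 
    (by rw [Finset.card_sdiff_of_subset himA]; omega) (by omega) (by
      rw [Finset.disjoint_left]
      intro x hx hy
      exact hAB x (Finset.mem_sdiff.1 hx).1 (hWB (mem_NO.1 hy).1))
    (fun x hx y hy => hAi x (Finset.mem_sdiff.1 hx).1 y (Finset.mem_sdiff.1 hy).1)
    (by
      intro w hw
      rw [mem_NO] at hw
      obtain ⟨a, ha⟩ := (hS.2 w hw.1).2
      rw [mem_SS] at ha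
      exact ⟨a, Finset.mem_sdiff.2 ⟨ha.1, fun h => hw.2 a h ha.2⟩, ha.2⟩) hp
  rw [mem_NO] at h4 h5
  -- choose the index
  have hidx : ∃ a ∈ T, ∀ n ∈ W, G.Adj a n → n ≠ d → ¬ G.Adj p n := by
    by_contra hcon
    push Not at hcon
    choose! g hg using hcon
    have gi : Set.InjOn g T := by
      intro a ha b hb hab
      by_contra hne
      have ga := hg a ha
      have gb := hg b hb
      rw [← hab] at gb
      exact ga.2.2.1 (huniq a ha b hb hne _ ga.1 ga.2.1 gb.2.1)
    have e1 : (T.image g).card = 3 := by rw [Finset.card_image_of_injOn gi, hT3]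
    have e2 : Disjoint (T.image g) (NW G (NO G W T) {p}) := by
      rw [Finset.disjoint_left]
      intro x hx hy
      rw [Finset.mem_image] at hx
      obtain ⟨a, ha, rfl⟩ := hx
      exact (mem_NO.1 (mem_NW.1 hy).1).2 a ha (hg a ha).2.1
    have e3 : T.image g ∪ NW G (NO G W T) {p} ⊆ NW G W {p} := by
      intro x hx
      rw [Finset.mem_union] at hx
      rw [mem_NW]
      rcases hx with hx | hx
      · rw [Finset.mem_image] at hx
        obtain ⟨a, ha, rfl⟩ := hx
        exact ⟨(hg a ha).1, p, by simp, (hg a ha).2.2.2⟩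
      · rw [mem_NW, mem_NO] at hx
        exact ⟨hx.1.1, hx.2⟩
    have e4 := Finset.card_le_card e3
    rw [Finset.card_union_of_disjoint e2] at e4
    have := hone p hpA
    omega
  obtain ⟨a, haT, ha⟩ := hidx
  obtain ⟨y, hyY, rfl⟩ := hTf a haT
  have mN : ∀ n, n ∈ (NW G W {f y}).erase d ↔ n ≠ d ∧ n ∈ W ∧ G.Adj (f y) n := by
    intro n; simp [mem_NW]
  have i1 : Ind G (insert p (T.erase (f y))) := by
    have : insert p (T.erase (f y)) ⊆ A := 
      Finset.insert_subset hpA ((Finset.erase_subset _ _).trans himA)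
    exact fun x hx z hz => hAi x (this hx) z (this hz)
  have i2 : Ind G (insert p (T.erase (f y)) ∪ Y.erase y) := by
    apply ind_union i1
    · exact fun x hx z hz => hYi x (Finset.mem_of_mem_erase hx) z (Finset.mem_of_mem_erase hz)
    · intro x hx z hz
      apply hLA z (hYL (Finset.mem_of_mem_erase hz))
      rw [Finset.mem_insert] at hx
      rcases hx with rfl | hx
      · exact hpA
      · exact himA (Finset.mem_of_mem_erase hx)
  have i3 : Ind G (insert w5 ((NW G W {f y}).erase d)) := by
    have key : ∀ n ∈ (NW G W {f y}).erase d, ¬ G.Adj w5 n := by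
      intro n hn hwn
      rw [mN] at hn
      rcases R1 hG hS.1 (hS.2 w5 h5.1).1 hwn h45.symm with hh | hh
      · have := hh (mem_SS.2 ⟨himA haT, hn.2.2⟩)
        exact h4.2 _ haT (mem_SS.1 this).2
      · have := hh (mem_SS.2 ⟨hpA, hp4⟩)
        exact ha n hn.2.1 hn.2.2 hn.1 (mem_SS.1 this).2
    intro x hx z hz hxz
    rw [Finset.mem_insert] at hx hz
    rcases hx with rfl | hx <;> rcases hz with rfl | hz
    · exact G.loopless.irrefl _ hxz
    · exact key z hz hxz
    · exact key x hx hxz.symm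
    · rw [mN] at hx hz
      exact hG.tf _ _ _ hx.2.2 hxz hz.2.2
  have i4 : Ind G ((insert p (T.erase (f y)) ∪ Y.erase y) ∪ insert w5 ((NW G W {f y}).erase d)) := by
    apply ind_union i2 i3
    intro x hx z hz hxz
    rw [Finset.mem_union, Finset.mem_insert] at hx
    rw [Finset.mem_insert, mN] at hz
    have kT : ∀ t ∈ T, t ≠ f y → ¬ G.Adj t z := by
      intro t ht htn htz
      rcases hz with rfl | hz
      · exact h5.2 t ht htz
      · exact hz.1 (huniq t ht (f y) haT htn z hz.2.1 htz hz.2.2)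
    have hzW : z ∈ W := by
      rcases hz with rfl | hz
      · exact h5.1
      · exact hz.2.1
    rcases hx with (rfl | hx) | hx
    · rcases hz with rfl | hz
      · exact hp5 hxz
      · exact ha z hz.2.1 hz.2.2 hz.1 hxz
    · rw [Finset.mem_erase] at hx
      exact kT x hx.2 hx.1 hxz
    · rw [Finset.mem_erase] at hx
      exact kT (f x) (hfT x hx.2) (fun e => hx.1 (hinj x hx.2 y hyY e)) ((hf x hx.2).2 z hzW hxz)
  have hsub1 : insert p (T.erase (f y)) ⊆ A := 
      Finset.insert_subset hpA ((Finset.erase_subset _ _).trans himA)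
  have hsub2 : Y.erase y ⊆ L := (Finset.erase_subset _ _).trans hYL
  have hsub3 : insert w5 ((NW G W {f y}).erase d) ⊆ W := 
    Finset.insert_subset h5.1 (fun n hn => ((mN n).1 hn).2.1)
  have hle := ind_le h i4 (Finset.union_subset (Finset.union_subset (hsub1.trans hAU) 
    (hsub2.trans (hLB.trans hBU))) (hsub3.trans (hWB.trans hBU)))
  have hdW' : d ∈ NW G W {f y} := mem_NW.2 ⟨hdW, f y, by simp, hdT _ haT⟩
  rw [Finset.card_union_of_disjoint, Finset.card_union_of_disjoint, Finset.card_insert_of_notMem,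
    Finset.card_insert_of_notMem, Finset.card_erase_of_mem haT, Finset.card_erase_of_mem hyY,
    Finset.card_erase_of_mem hdW', hT4 _ haT] at hle
  · omega
  · intro hh
    exact h5.2 _ haT ((mN _).1 hh).2.2
  · intro hh
    exact hpT (Finset.mem_of_mem_erase hh)
  · rw [Finset.disjoint_left]
    intro x hx hy
    exact hAB x (hsub1 hx) (hLB (hsub2 hy))
  · rw [Finset.disjoint_left]
    intro x hx hy
    rw [Finset.mem_union] at hx
    rcases hx with hx | hx
    · exact hAB x (hsub1 hx) (hWB (hsub3 hy))
    · exact hLW x (hsub2 hx) (hsub3 hy)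

theorem deg_le5 (hG : CG G) {U : Finset V} (hU : U.card = 26) (h : IRle G U 8) {v : V}
    (hv : v ∈ U) : (NN G U v).card ≤ 5 := by
  have h8 := NN_le (v := v) hG h
  have c1 := card_BB (G := G) hv
  have c2 := card_L23 (G := G) (U := U) (v := v)
  have a := lemA (j := 7) hG hv h (by omega)
  have a' := lemA' (j := 7) hG hv h (by omega)
  by_contra hcon
  have h3 := g2 hG (L3_IR (v := v) (j := 2) hG h (by omega))
  by_cases h0 : 0 < (L3 G U v).card
  · have := a' h0
    by_cases h6 : (NN G U v).card = 6
    · omega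
    · have h3 := g1 hG (L3_IR (v := v) (j := 1) hG h (by omega))
      by_cases h7 : (NN G U v).card = 7
      · omega
      · have := g0 (L3_IR (v := v) (j := 0) hG h (by omega))
        omega
  · omega

theorem main (hG : CG G) {U : Finset V} (hU : U.card = 26) (h : IRle G U 8) : False := by
  apply partII hG hU h
  intro x hx
  have := deg_le5 hG hU h hx
  by_contra hc
  exact deg5 hG hU h (fun y hy => deg_le5 hG hU h hy) hx (by omega)

end IRR

namespace IRR
theorem cg_of (G : SimpleGraph (Fin 26)) [DecidableRel G.Adj]
    (h3 : ¬ ∃ X : Finset (Fin 26), X.card = 3 ∧ Gᶜ.IsIrredundant X) : CG G := by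
  have tf : ∀ a b c, G.Adj a b → G.Adj b c → ¬ G.Adj a c := by
    intro a b c h1 h2 h4
    apply h3
    refine ⟨{a, b, c}, Finset.card_eq_three.2 ⟨a, b, c, h1.ne, h4.ne, h2.ne, rfl⟩, ?_⟩
    intro x hx
    left
    intro y hy
    rw [SimpleGraph.compl_adj]
    rintro ⟨hne, hn⟩
    simp only [Finset.mem_insert, Finset.mem_singleton] at hx hy
    rcases hx with rfl | rfl | rfl <;> rcases hy with rfl | rfl | rfl <;>
      first | exact hne rfl | exact hn h1 | exact hn h1.symm | exact hn h2 | exact hn h2.symm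
            | exact hn h4 | exact hn h4.symm
  refine ⟨tf, ?_⟩
  intro a b c d e f h1 h2 h4 h5 h6 h7
  by_contra hcon
  push Not at hcon
  obtain ⟨n1, n2, n3⟩ := hcon
  have ac : a ≠ c := by rintro rfl; exact n1 h4
  have ce : c ≠ e := by rintro rfl; exact n3 h6
  have ae : a ≠ e := by rintro rfl; exact n2 h1.symm
  have ad : a ≠ d := by rintro rfl; exact tf _ _ _ h1 h2 h4.symm
  have be : b ≠ e := by rintro rfl; exact tf _ _ _ h2 h4 h5.symm
  have cf : c ≠ f := by rintro rfl; exact tf _ _ _ h4 h5 h6.symm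
  apply h3
  refine ⟨{a, c, e}, Finset.card_eq_three.2 ⟨a, c, e, ac, ae, ce, rfl⟩, ?_⟩
  intro x hx
  right
  simp only [Finset.mem_insert, Finset.mem_singleton] at hx
  rcases hx with rfl | rfl | rfl
  · refine ⟨d, ?_, by rw [SimpleGraph.compl_adj]; exact ⟨ad, n1⟩, ?_⟩
    · simp only [Finset.mem_insert, Finset.mem_singleton]
      rintro (h | h | h)
      · exact ad h.symm
      · exact h4.ne h.symm
      · exact h5.ne h
    · intro z hz hzx
      rw [SimpleGraph.compl_adj]
      rintro ⟨_, hn⟩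
      simp only [Finset.mem_insert, Finset.mem_singleton] at hz
      rcases hz with rfl | rfl | rfl
      · exact hzx rfl
      · exact hn h4
      · exact hn h5.symm
  · refine ⟨f, ?_, by rw [SimpleGraph.compl_adj]; exact ⟨cf, n3⟩, ?_⟩
    · simp only [Finset.mem_insert, Finset.mem_singleton]
      rintro (h | h | h)
      · exact h7.ne h
      · exact cf h.symm
      · exact h6.ne h.symm
    · intro z hz hzx
      rw [SimpleGraph.compl_adj]
      rintro ⟨_, hn⟩
      simp only [Finset.mem_insert, Finset.mem_singleton] at hz
      rcases hz with rfl | rfl | rfl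
      · exact hn h7.symm
      · exact hzx rfl
      · exact hn h6
  · refine ⟨b, ?_, by rw [SimpleGraph.compl_adj]; exact ⟨be.symm, fun h => n2 h.symm⟩, ?_⟩
    · simp only [Finset.mem_insert, Finset.mem_singleton]
      rintro (h | h | h)
      · exact h1.ne h.symm
      · exact h2.ne h
      · exact be h
    · intro z hz hzx
      rw [SimpleGraph.compl_adj]
      rintro ⟨_, hn⟩
      simp only [Finset.mem_insert, Finset.mem_singleton] at hz
      rcases hz with rfl | rfl | rfl
      · exact hn h1
      · exact hn h2.symm
      · exact hzx rfl

theorem ir_of (G : SimpleGraph (Fin 26)) [DecidableRel G.Adj]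
    (h9 : ¬ ∃ X : Finset (Fin 26), X.card = 9 ∧ G.IsIrredundant X) : 
    IRle G Finset.univ 8 := by
  intro X hX
  by_contra hc
  obtain ⟨Y, hY, hYc⟩ := Finset.exists_subset_card_eq (by omega : 9 ≤ X.card)
  apply h9
  refine ⟨Y, hYc, fun x hx => ?_⟩
  rcases hX.2 x (hY hx) with h | ⟨y, _, h1, h2, h3⟩
  · exact Or.inl (fun y hy => h y (hY hy))
  · exact Or.inr ⟨y, fun h => h1 (hY h), h2, fun z hz => h3 z (hY hz)⟩
end IRR

theorem good_graph_is_5_regular (G : SimpleGraph (Fin 26)) [DecidableRel G.Adj]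
    (h9 : ¬ ∃ X : Finset (Fin 26), X.card = 9 ∧ G.IsIrredundant X)
    (h3 : ¬ ∃ X : Finset (Fin 26), X.card = 3 ∧ Gᶜ.IsIrredundant X) :
    ∀ v : Fin 26, G.degree v = 5 := by
  
  intro v
  exact (IRR.main (IRR.cg_of G h3) (U := Finset.univ) (by simp) (IRR.ir_of G h9)).elim
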